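/- arXiv:2504.18409 — 6 statements merged into one kernel-verified Lean document; each statement's English description precedes it below -/
import Mathlib

section
/- For every integer n ≥ 2 and every f ∈ L²(π), the Dirichlet forms of the semi-ideal kernels satisfy (n−1)·ℰ(P̃_n, f) ≤ n·ℰ(P̃_{n−1}, f). -/
open MeasureTheory ENNReal Finset

noncomputable section

/-- `ℝ^d` with Lebesgue measure. -/
abbrev Rd (d : ℕ) := Fin d → ℝ

variable {d : ℕ}

/-- `(qw)(x) = ∫ q(x,y) w(x,y) dy`. -/
def qwInt (q w : Rd d → Rd d → ℝ) (x : Rd d) : ℝ := ∫ y, q x y * w x y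

/-- The importance weights `ϖ(x,y) = w(x,y)/(qw)(x)`. -/
def impW (q w : Rd d → Rd d → ℝ) (x y : Rd d) : ℝ := w x y / qwInt q w x

/-- `r(x,y) = (π(y) q(y,x) w(y,x)) / (π(x) q(x,y) w(x,y))`. -/
def accRatio (pi : Rd d → ℝ) (q w : Rd d → Rd d → ℝ) (x y : Rd d) : ℝ :=
  (pi y * q y x * w y x) / (pi x * q x y * w x y)

/-- `(q̃w)ₙ(x,y)`, the harmonic-mean normalisation of the resampling proposal. -/
def qtw (q w : Rd d → Rd d → ℝ) (n : ℕ) (x y : Rd d) : ℝ :=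
  (∫ ys : Fin (n - 1) → Rd d,
    ((w x y + ∑ i, w x (ys i)) / n)⁻¹ * ∏ i, q x (ys i))⁻¹

/-- Off-diagonal transition density of the semi-ideal kernel `P̃ₙ`. -/
def pSemi (pi : Rd d → ℝ) (q w : Rd d → Rd d → ℝ) (n : ℕ) (x y : Rd d) : ℝ :=
  q x y * w x y *
    min (qtw q w n x y)⁻¹ (accRatio pi q w x y / qtw q w n y x)

/-- Off-diagonal transition density of the Multiple-try Metropolis kernel `Pₙ`. -/
def pMTM (pi : Rd d → ℝ) (q w : Rd d → Rd d → ℝ) (n : ℕ) (x y : Rd d) : ℝ :=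
  q x y * w x y *
    ∫ ys : Fin (n - 1) → Rd d, ∫ zs : Fin (n - 1) → Rd d,
      min ((n : ℝ) / (w x y + ∑ i, w x (ys i)))
          (accRatio pi q w x y * n / (w y x + ∑ i, w y (zs i))) *
        ((∏ i, q x (ys i)) * ∏ i, q y (zs i))

/-- Off-diagonal transition density of the ideal kernel `P_∞`. -/
def pIdeal (pi : Rd d → ℝ) (q w : Rd d → Rd d → ℝ) (x y : Rd d) : ℝ :=
  q x y * w x y / qwInt q w x *
    min 1 (accRatio pi q w x y * qwInt q w x / qwInt q w y)

/-- The Dirichlet form `ℰ(P,f) = (1/2) ∫∫ (f(x) - f(y))² p(x,y) π(x) dx dy`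
of a kernel with off-diagonal density `p`. -/
def dform (pi : Rd d → ℝ) (p : Rd d → Rd d → ℝ) (f : Rd d → ℝ) : ℝ≥0∞ :=
  (1 / 2 : ℝ≥0∞) * ∫⁻ x, ∫⁻ y, ENNReal.ofReal ((f x - f y) ^ 2 * p x y * pi x)

/-- The probability measure with density `π` with respect to Lebesgue measure. -/
def piMeasure (pi : Rd d → ℝ) : Measure (Rd d) :=
  volume.withDensity fun x => ENNReal.ofReal (pi x)

/-- The oscillation seminorm `‖f‖_osc = esssup_π f - essinf_π f`, expressed in
`ℝ≥0∞` as the essential supremum of `(f(x) - f(y))⁺` under `π ⊗ π`. -/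
def oscSeminorm (pi : Rd d → ℝ) (f : Rd d → ℝ) : ℝ≥0∞ :=
  essSup (fun p : Rd d × Rd d => ENNReal.ofReal (f p.1 - f p.2))
    ((piMeasure pi).prod (piMeasure pi))

/-- The harmonic-mean integral of the weights under i.i.d. proposals, without the factor `n`. -/
def harmonicInt (q w : Rd d → Rd d → ℝ) (m : ℕ) (x y : Rd d) : ℝ :=
  ∫ ys : Fin m → Rd d, (w x y + ∑ i, w x (ys i))⁻¹ * ∏ i, q x (ys i)

theorem inv_qtw (q w : Rd d → Rd d → ℝ) (n : ℕ) (x y : Rd d) :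
    (qtw q w n x y)⁻¹ = n * harmonicInt q w (n - 1) x y := by
  rw [qtw, inv_inv, harmonicInt, ← integral_const_mul]
  congr with ys
  rw [inv_div, div_eq_mul_inv, mul_assoc]

theorem integrable_harmonicInt_integrand {q w : Rd d → Rd d → ℝ}
    (hq_prob : ∀ x, (∫ y, q x y) = 1)
    (hw_meas : Measurable (Function.uncurry w)) (hw_pos : ∀ x y, 0 < w x y)
    (m : ℕ) (x y : Rd d) :
    Integrable fun ys : Fin m → Rd d =>
      (w x y + ∑ i, w x (ys i))⁻¹ * ∏ i, q x (ys i) := by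
  have hq_int : Integrable (q x) := .of_integral_ne_zero (by simp [hq_prob x])
  have hprod : Integrable fun ys : Fin m → Rd d => ∏ i, q x (ys i) :=
    Integrable.fintype_prod fun _ => hq_int
  have hw_x : Measurable (w x) := hw_meas.of_uncurry_left
  refine hprod.bdd_mul (c := (w x y)⁻¹) (Measurable.aestronglyMeasurable (by fun_prop))
    (.of_forall fun ys => ?_)
  have hsum : 0 ≤ ∑ i, w x (ys i) := Finset.sum_nonneg fun _ _ => (hw_pos _ _).le
  have hw_xy := hw_pos x y
  rw [Real.norm_of_nonneg (by positivity)]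
  gcongr
  linarith

theorem harmonicInt_succ_le {q w : Rd d → Rd d → ℝ}
    (hq_pos : ∀ x y, 0 < q x y) (hq_prob : ∀ x, (∫ y, q x y) = 1)
    (hw_meas : Measurable (Function.uncurry w)) (hw_pos : ∀ x y, 0 < w x y)
    (m : ℕ) (x y : Rd d) :
    harmonicInt q w (m + 1) x y ≤ harmonicInt q w m x y := by
  have hq_int : Integrable (q x) := .of_integral_ne_zero (by simp [hq_prob x])
  have hmp := (volume_preserving_piFinSuccAbove (fun _ : Fin (m + 1) => Rd d) 0).symm
  calc harmonicInt q w (m + 1) x y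
      = ∫ z : Rd d × (Fin m → Rd d), (w x y + (w x z.1 + ∑ i, w x (z.2 i)))⁻¹ *
          (q x z.1 * ∏ i, q x (z.2 i)) := by
        rw [harmonicInt, ← hmp.integral_comp (MeasurableEquiv.measurableEmbedding _)]
        simp [MeasurableEquiv.piFinSuccAbove, Fin.sum_univ_succ, Fin.prod_univ_succ]
    _ ≤ ∫ z : Rd d × (Fin m → Rd d),
          q x z.1 * ((w x y + ∑ i, w x (z.2 i))⁻¹ * ∏ i, q x (z.2 i)) := by
        have hint := integrable_harmonicInt_integrand hq_prob hw_meas hw_pos m x y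
        refine integral_mono_of_nonneg (.of_forall fun z => ?_) (hq_int.mul_prod hint)
          (.of_forall fun z => ?_)
        all_goals
          have hsum : 0 ≤ ∑ i, w x (z.2 i) := Finset.sum_nonneg fun _ _ => (hw_pos _ _).le
          have hprod : 0 ≤ ∏ i, q x (z.2 i) := Finset.prod_nonneg fun _ _ => (hq_pos _ _).le
          have hw_xy := hw_pos x y
          have hw_z := hw_pos x z.1
          have hq_z := hq_pos x z.1
        · simp only [Pi.zero_apply]
          positivity
        · simp only
          rw [mul_left_comm (q x z.1)]
          gcongr
          linarith
    _ = harmonicInt q w m x y := by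
        rw [Measure.volume_eq_prod, integral_prod_mul (q x)
          (fun ys : Fin m → Rd d => (w x y + ∑ i, w x (ys i))⁻¹ * ∏ i, q x (ys i)),
          hq_prob, one_mul, harmonicInt]

theorem pSemi_succ_le {pi : Rd d → ℝ} {q w : Rd d → Rd d → ℝ}
    (hpi_pos : ∀ x, 0 < pi x)
    (hq_pos : ∀ x y, 0 < q x y) (hq_prob : ∀ x, (∫ y, q x y) = 1)
    (hw_meas : Measurable (Function.uncurry w)) (hw_pos : ∀ x y, 0 < w x y)
    (m : ℕ) (x y : Rd d) :
    ((m + 1 : ℕ) : ℝ) * pSemi pi q w (m + 2) x y ≤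
      ((m + 2 : ℕ) : ℝ) * pSemi pi q w (m + 1) x y := by
  have hr : 0 ≤ accRatio pi q w x y := by
    have := hpi_pos x; have := hpi_pos y; have := hq_pos x y; have := hq_pos y x
    have := hw_pos x y; have := hw_pos y x
    unfold accRatio
    positivity
  have hqw : 0 ≤ q x y * w x y := (mul_pos (hq_pos x y) (hw_pos x y)).le
  have key (x y : Rd d) : ((m + 1 : ℕ) : ℝ) * (qtw q w (m + 2) x y)⁻¹ ≤
      ((m + 2 : ℕ) : ℝ) * (qtw q w (m + 1) x y)⁻¹ := by
    rw [inv_qtw, inv_qtw, mul_left_comm]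
    gcongr
    exact harmonicInt_succ_le hq_pos hq_prob hw_meas hw_pos m x y
  simp only [pSemi, div_eq_mul_inv]
  rw [mul_left_comm, mul_left_comm ((m + 2 : ℕ) : ℝ), mul_min_of_nonneg _ _ (Nat.cast_nonneg _),
    mul_min_of_nonneg _ _ (Nat.cast_nonneg _), mul_left_comm _ (accRatio pi q w x y),
    mul_left_comm _ (accRatio pi q w x y)]
  gcongr ?_ * min ?_ (?_ * ?_)
  · exact key x y
  · exact key y x

/-- A pointwise comparison of off-diagonal densities yields a comparison of Dirichlet forms. -/
theorem natCast_mul_dform_le {pi : Rd d → ℝ} {p p' : Rd d → Rd d → ℝ} {a b : ℕ}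
    (hpi : ∀ x, 0 ≤ pi x) (h : ∀ x y, (a : ℝ) * p x y ≤ b * p' x y) (f : Rd d → ℝ) :
    (a : ℝ≥0∞) * dform pi p f ≤ b * dform pi p' f := by
  simp only [dform]
  rw [mul_left_comm, mul_left_comm (b : ℝ≥0∞)]
  simp_rw [← lintegral_const_mul' _ _ (ENNReal.natCast_ne_top _)]
  refine mul_le_mul' le_rfl (lintegral_mono fun x => lintegral_mono fun y => ?_)
  rw [← ENNReal.ofReal_natCast, ← ENNReal.ofReal_natCast,
    ← ENNReal.ofReal_mul (Nat.cast_nonneg _), ← ENNReal.ofReal_mul (Nat.cast_nonneg _)]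
  apply ENNReal.ofReal_le_ofReal
  have := mul_le_mul_of_nonneg_left (h x y) (mul_nonneg (sq_nonneg (f x - f y)) (hpi x))
  linarith

/-- Adding one proposal to the semi-ideal chain improves the Dirichlet form by at
most a factor `n/(n-1)`: `(n-1) ℰ(P̃ₙ, f) ≤ n ℰ(P̃ₙ₋₁, f)`. -/
theorem semi_ideal_dirichlet_comparison {d : ℕ}
    (pi : Rd d → ℝ) (q w : Rd d → Rd d → ℝ)
    (hpi_meas : Measurable pi) (hpi_pos : ∀ x, 0 < pi x)
    (hpi_prob : (∫ x, pi x) = 1)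
    (hq_meas : Measurable (Function.uncurry q)) (hq_pos : ∀ x y, 0 < q x y)
    (hq_prob : ∀ x, (∫ y, q x y) = 1)
    (hw_meas : Measurable (Function.uncurry w)) (hw_pos : ∀ x y, 0 < w x y)
    (hqw_int : ∀ x, Integrable fun y => q x y * w x y)
    (n : ℕ) (hn : 2 ≤ n)
    (f : Rd d → ℝ) (hf_meas : Measurable f)
    (hf2 : Integrable fun x => f x ^ 2 * pi x) :
    ((n - 1 : ℕ) : ℝ≥0∞) * dform pi (pSemi pi q w n) f ≤
      (n : ℝ≥0∞) * dform pi (pSemi pi q w (n - 1)) f := by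
  obtain ⟨m, rfl⟩ := Nat.exists_eq_add_of_le' hn
  exact natCast_mul_dform_le (fun x => (hpi_pos x).le)
    (pSemi_succ_le hpi_pos hq_pos hq_prob hw_meas hw_pos m) f

end
end

section
/- For every integer n ≥ 2 and every f ∈ L²(π), the Dirichlet forms of the Multiple-try Metropolis kernels satisfy (n−1)·ℰ(P_n, f) ≤ n·ℰ(P_{n−1}, f). -/
open MeasureTheory ENNReal Finset

noncomputable section

variable {d : ℕ}

/-- A bounded measurable function times a product of copies of an integrable density
is integrable. -/
lemma integrable_bdd_mul_prod_density {k : ℕ} {ρ : Rd d → ℝ} (hρ : Integrable ρ)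
    {h : (Fin k → Rd d) → ℝ} (hm : Measurable h) {C : ℝ} (hC : ∀ v, |h v| ≤ C) :
    Integrable fun v => h v * ∏ i, ρ (v i) :=
  (Integrable.fintype_prod (μ := fun _ : Fin k => (volume : Measure (Rd d)))
    (fun _ => hρ)).bdd_mul hm.aestronglyMeasurable (Filter.Eventually.of_forall hC)

/-- Integrating out one coordinate of a product of copies of a probability density. -/
lemma integral_tail_mul_prod_density {k : ℕ} {ρ : Rd d → ℝ} (hρ1 : ∫ y, ρ y = 1)
    (h : (Fin k → Rd d) → ℝ) :
    ∫ v : Fin (k + 1) → Rd d, h (Fin.tail v) * ∏ i, ρ (v i) =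
      ∫ v, h v * ∏ i, ρ (v i) := by
  have e := (volume_preserving_piFinSuccAbove (fun _ : Fin (k + 1) => Rd d) 0).integral_comp'
    (fun p => ρ p.1 * (h p.2 * ∏ i, ρ (p.2 i)))
  have hprod := integral_prod_mul (μ := (volume : Measure (Rd d)))
    (ν := (volume : Measure (Fin k → Rd d))) ρ (fun v => h v * ∏ i, ρ (v i))
  rw [hρ1, one_mul] at hprod
  rw [← hprod]
  refine Eq.trans (integral_congr_ae (Filter.Eventually.of_forall fun v => ?_)) e
  simp only [Fin.prod_univ_succ]
  exact mul_left_comm _ _ _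

/-- A function on `k + 1` points dominated by a bounded function of the last `k` points has a
smaller mean under the product of copies of a probability density. -/
lemma integral_mul_prod_density_le_of_tail {k : ℕ} {ρ : Rd d → ℝ} (hρ0 : ∀ y, 0 ≤ ρ y)
    (hρ1 : ∫ y, ρ y = 1) {g : (Fin (k + 1) → Rd d) → ℝ} {h : (Fin k → Rd d) → ℝ}
    (hm : Measurable h) {C : ℝ} (hC : ∀ v, |h v| ≤ C) (hg : ∀ v, 0 ≤ g v)
    (hgh : ∀ v, g v ≤ h (Fin.tail v)) :
    ∫ v, g v * ∏ i, ρ (v i) ≤ ∫ v, h v * ∏ i, ρ (v i) := by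
  have hρ : Integrable ρ := Integrable.of_integral_ne_zero (by simp [hρ1])
  have htail : Measurable fun v : Fin (k + 1) → Rd d => Fin.tail v :=
    measurable_pi_lambda _ fun i => measurable_pi_apply i.succ
  have hP : ∀ v : Fin (k + 1) → Rd d, 0 ≤ ∏ i, ρ (v i) :=
    fun v => prod_nonneg fun i _ => hρ0 _
  rw [← integral_tail_mul_prod_density hρ1 h]
  exact integral_mono_of_nonneg
    (Filter.Eventually.of_forall fun v => mul_nonneg (hg v) (hP v))
    (integrable_bdd_mul_prod_density hρ (hm.comp htail) fun v => hC _)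
    (Filter.Eventually.of_forall fun v => mul_le_mul_of_nonneg_right (hgh v) (hP v))

/-- The two-sample version of `integral_mul_prod_density_le_of_tail`. -/
lemma integral_integral_mul_prod_density_le_of_tail {k : ℕ} {ρ σ : Rd d → ℝ}
    (hρ0 : ∀ y, 0 ≤ ρ y) (hρ1 : ∫ y, ρ y = 1)
    (hσ0 : ∀ y, 0 ≤ σ y) (hσ1 : ∫ y, σ y = 1) (hσm : Measurable σ)
    {F : (Fin (k + 1) → Rd d) → (Fin (k + 1) → Rd d) → ℝ}
    {G : (Fin k → Rd d) → (Fin k → Rd d) → ℝ} (hGm : Measurable (Function.uncurry G))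
    {C : ℝ} (hG0 : ∀ u v, 0 ≤ G u v) (hGC : ∀ u v, G u v ≤ C) (hF0 : ∀ u v, 0 ≤ F u v)
    (hFG : ∀ u v, F u v ≤ G (Fin.tail u) (Fin.tail v)) :
    ∫ u, ∫ v, F u v * ((∏ i, ρ (u i)) * ∏ i, σ (v i)) ≤
      ∫ u, ∫ v, G u v * ((∏ i, ρ (u i)) * ∏ i, σ (v i)) := by
  have factor : ∀ {m : ℕ} (K : (Fin m → Rd d) → (Fin m → Rd d) → ℝ) (u : Fin m → Rd d),
      ∫ v, K u v * ((∏ i, ρ (u i)) * ∏ i, σ (v i)) =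
        (∫ v, K u v * ∏ i, σ (v i)) * ∏ i, ρ (u i) := fun K u => by
    rw [← integral_mul_const]
    exact integral_congr_ae (Filter.Eventually.of_forall fun v => by ring)
  have hσ : Integrable σ := Integrable.of_integral_ne_zero (by simp [hσ1])
  have hP : ∀ {m : ℕ} (v : Fin m → Rd d), 0 ≤ ∏ i, σ (v i) :=
    fun v => prod_nonneg fun i _ => hσ0 _
  have hGabs : ∀ u v, |G u v| ≤ C := fun u v => by
    rw [abs_of_nonneg (hG0 u v)]; exact hGC u v
  have hGmu : ∀ u, Measurable (G u) := fun u => hGm.comp measurable_prodMk_left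
  have hinner0 : ∀ u, 0 ≤ ∫ v, G u v * ∏ i, σ (v i) := fun u =>
    integral_nonneg fun v => mul_nonneg (hG0 u v) (hP v)
  simp only [factor]
  refine integral_mul_prod_density_le_of_tail hρ0 hρ1
    (h := fun u => ∫ v, G u v * ∏ i, σ (v i)) (C := ∫ v : Fin k → Rd d, C * ∏ i, σ (v i))
    ?_ (fun u => ?_) (fun u => ?_) (fun u => ?_)
  · have : Measurable fun p : (Fin k → Rd d) × (Fin k → Rd d) =>
        Function.uncurry G p * ∏ i, σ (p.2 i) := by fun_prop
    exact this.stronglyMeasurable.integral_prod_right.measurable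
  · rw [abs_of_nonneg (hinner0 u)]
    exact integral_mono (integrable_bdd_mul_prod_density hσ (hGmu u) (hGabs u))
      (integrable_bdd_mul_prod_density hσ measurable_const fun _ => le_rfl)
      fun v => mul_le_mul_of_nonneg_right (hGC u v) (hP v)
  · exact integral_nonneg fun v => mul_nonneg (hF0 u v) (hP v)
  · exact integral_mul_prod_density_le_of_tail hσ0 hσ1 (hGmu _) (hGabs _) (hF0 u) (hFG u)

/-- Pointwise comparison of the off-diagonal densities of consecutive Multiple-try Metropolis
kernels. -/
lemma pMTM_succ_le (pi : Rd d → ℝ) (q w : Rd d → Rd d → ℝ) (hpi_pos : ∀ x, 0 < pi x)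
    (hq_meas : Measurable (Function.uncurry q)) (hq_pos : ∀ x y, 0 < q x y)
    (hq_prob : ∀ x, (∫ y, q x y) = 1)
    (hw_meas : Measurable (Function.uncurry w)) (hw_pos : ∀ x y, 0 < w x y)
    (k : ℕ) (x y : Rd d) :
    ((k + 1 : ℕ) : ℝ) * pMTM pi q w (k + 2) x y ≤
      ((k + 2 : ℕ) : ℝ) * pMTM pi q w (k + 1) x y := by
  have hr : 0 < accRatio pi q w x y :=
    div_pos (mul_pos (mul_pos (hpi_pos _) (hq_pos _ _)) (hw_pos _ _))
      (mul_pos (mul_pos (hpi_pos _) (hq_pos _ _)) (hw_pos _ _))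
  set r := accRatio pi q w x y
  have hS : ∀ {m : ℕ} (a : Rd d) (u : Fin m → Rd d), 0 ≤ ∑ i, w a (u i) :=
    fun a u => sum_nonneg fun i _ => (hw_pos _ _).le
  have hD : ∀ {m : ℕ} (a b : Rd d) (u : Fin m → Rd d), 0 < w a b + ∑ i, w a (u i) :=
    fun a b u => add_pos_of_pos_of_nonneg (hw_pos a b) (hS a u)
  have hDtail : ∀ (a b : Rd d) (u : Fin (k + 1) → Rd d),
      w a b + ∑ i, w a (Fin.tail u i) ≤ w a b + ∑ i, w a (u i) := fun a b u => by
    rw [Fin.sum_univ_succ]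
    have := (hw_pos a (u 0)).le
    simp only [Fin.tail]
    linarith
  have hwm : ∀ a, Measurable (w a) := fun a => hw_meas.comp measurable_prodMk_left
  have hqm : ∀ a, Measurable (q a) := fun a => hq_meas.comp measurable_prodMk_left
  let A : ∀ m : ℕ, (Fin m → Rd d) → (Fin m → Rd d) → ℝ := fun m u v =>
    min (((m + 1 : ℕ) : ℝ) / (w x y + ∑ i, w x (u i)))
      (r * ((m + 1 : ℕ) : ℝ) / (w y x + ∑ i, w y (v i)))
  have hA0 : ∀ m u v, 0 ≤ A m u v := fun m u v =>
    le_min (div_nonneg (by positivity) (hD x y u).le)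
      (div_nonneg (by positivity) (hD y x v).le)
  have key := integral_integral_mul_prod_density_le_of_tail (k := k)
    (fun z => (hq_pos x z).le) (hq_prob x) (fun z => (hq_pos y z).le) (hq_prob y) (hqm y)
    (F := fun u v => ((k + 1 : ℕ) : ℝ) * A (k + 1) u v)
    (G := fun u v => ((k + 2 : ℕ) : ℝ) * A k u v)
    (C := ((k + 2 : ℕ) : ℝ) * (((k + 1 : ℕ) : ℝ) / w x y))
    ?_ (fun u v => mul_nonneg (by positivity) (hA0 k u v)) (fun u v => ?_)
    (fun u v => mul_nonneg (by positivity) (hA0 (k + 1) u v)) (fun u v => ?_)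
  · simp only [mul_assoc (Nat.cast _ : ℝ), integral_const_mul] at key
    have h := mul_le_mul_of_nonneg_left key (mul_pos (hq_pos x y) (hw_pos x y)).le
    calc _ = _ := mul_left_comm _ _ _
      _ ≤ _ := h
      _ = _ := mul_left_comm _ _ _
  · simp only [A, Function.uncurry_def]
    have := hwm x
    have := hwm y
    fun_prop
  · refine mul_le_mul_of_nonneg_left ((min_le_left _ _).trans ?_) (by positivity)
    exact div_le_div_of_nonneg_left (by positivity) (hw_pos x y)
      (le_add_of_nonneg_right (hS x u))
  · simp only [A]
    rw [mul_min_of_nonneg _ _ (by positivity), mul_min_of_nonneg _ _ (by positivity)]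
    refine min_le_min ?_ ?_
    · rw [← mul_div_assoc, ← mul_div_assoc, mul_comm ((k + 2 : ℕ) : ℝ)]
      exact div_le_div_of_nonneg_left (by positivity) (hD _ _ _) (hDtail x y u)
    · rw [← mul_div_assoc, ← mul_div_assoc, mul_left_comm, mul_left_comm ((k + 2 : ℕ) : ℝ),
        mul_comm ((k + 2 : ℕ) : ℝ)]
      exact div_le_div_of_nonneg_left (by positivity) (hD _ _ _) (hDtail y x v)

/-- Dirichlet forms inherit a pointwise comparison of off-diagonal densities. -/
lemma mul_dform_le_mul_dform {pi : Rd d → ℝ} (hpi : ∀ x, 0 ≤ pi x) {p p' : Rd d → Rd d → ℝ}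
    {a b : ℕ} (h : ∀ x y, (a : ℝ) * p x y ≤ b * p' x y) (f : Rd d → ℝ) :
    (a : ℝ≥0∞) * dform pi p f ≤ b * dform pi p' f := by
  unfold dform
  rw [mul_left_comm, mul_left_comm (b : ℝ≥0∞)]
  simp only [← lintegral_const_mul' _ _ (natCast_ne_top _)]
  refine mul_le_mul_right (lintegral_mono fun x => lintegral_mono fun y => ?_) _
  rw [← ofReal_natCast a, ← ofReal_natCast b, ← ofReal_mul (by positivity),
    ← ofReal_mul (by positivity)]
  refine ofReal_le_ofReal ?_
  have := mul_le_mul_of_nonneg_left (h x y) (mul_nonneg (sq_nonneg (f x - f y)) (hpi x))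
  linarith

/-- Adding one proposal to the Multiple-try Metropolis chain improves the Dirichlet
form by at most a factor `n/(n-1)`: `(n-1) ℰ(Pₙ, f) ≤ n ℰ(Pₙ₋₁, f)`. -/
theorem mtm_dirichlet_comparison {d : ℕ}
    (pi : Rd d → ℝ) (q w : Rd d → Rd d → ℝ)
    (hpi_meas : Measurable pi) (hpi_pos : ∀ x, 0 < pi x)
    (hpi_prob : (∫ x, pi x) = 1)
    (hq_meas : Measurable (Function.uncurry q)) (hq_pos : ∀ x y, 0 < q x y)
    (hq_prob : ∀ x, (∫ y, q x y) = 1)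
    (hw_meas : Measurable (Function.uncurry w)) (hw_pos : ∀ x y, 0 < w x y)
    (hqw_int : ∀ x, Integrable fun y => q x y * w x y)
    (n : ℕ) (hn : 2 ≤ n)
    (f : Rd d → ℝ) (hf_meas : Measurable f)
    (hf2 : Integrable fun x => f x ^ 2 * pi x) :
    ((n - 1 : ℕ) : ℝ≥0∞) * dform pi (pMTM pi q w n) f ≤
      (n : ℝ≥0∞) * dform pi (pMTM pi q w (n - 1)) f := by
  obtain ⟨k, rfl⟩ := Nat.exists_eq_add_of_le' hn
  exact mul_dform_le_mul_dform (fun x => (hpi_pos x).le)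
    (pMTM_succ_le pi q w hpi_pos hq_meas hq_pos hq_prob hw_meas hw_pos k) f

end
end

section
/- Suppose the importance weights are uniformly bounded: there is M ∈ (0,∞) with ϖ(x,y) ≤ M for all x, y ∈ ℝ^d. Then for every n ≥ 1 and every f ∈ L²(π), ℰ(P̃_n, f) ≥ M^{−1} · ℰ(P_∞, f). -/
open MeasureTheory ENNReal Finset

noncomputable section

variable {d : ℕ}

/-- The normalising constant `(qw)(x)` is positive. -/
theorem qwInt_pos {d : ℕ} {q w : Rd d → Rd d → ℝ} (hq_pos : ∀ x y, 0 < q x y)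
    (hw_pos : ∀ x y, 0 < w x y) (hqw_int : ∀ x, Integrable fun y => q x y * w x y) (x : Rd d) :
    0 < qwInt q w x := by
  have hpos : ∀ y, 0 < q x y * w x y := fun y => mul_pos (hq_pos x y) (hw_pos x y)
  unfold qwInt
  rw [integral_pos_iff_support_of_nonneg (fun y => (hpos y).le) (hqw_int x)]
  have hsupp : Function.support (fun y => q x y * w x y) = Set.univ :=
    Set.eq_univ_of_forall fun y => (hpos y).ne'
  rw [hsupp]
  exact Measure.measure_univ_pos.2 (NeZero.ne _)

/-- If the importance weights are at most `M`, then `(q̃w)ₙ(x,y) ≤ M (qw)(x)`, stated for the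
reciprocals. -/
theorem inv_mul_qwInt_le_inv_qtw {d : ℕ} {q w : Rd d → Rd d → ℝ}
    (hq_pos : ∀ x y, 0 < q x y)
    (hq_prob : ∀ x, (∫ y, q x y) = 1)
    (hw_meas : Measurable (Function.uncurry w)) (hw_pos : ∀ x y, 0 < w x y)
    (hqw_int : ∀ x, Integrable fun y => q x y * w x y)
    {M : ℝ} (hbound : ∀ x y : Rd d, impW q w x y ≤ M)
    {n : ℕ} (hn : 1 ≤ n) (x y : Rd d) :
    (M * qwInt q w x)⁻¹ ≤ (qtw q w n x y)⁻¹ := by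
  have hQ := qwInt_pos hq_pos hw_pos hqw_int x
  have hw_le : ∀ z, w x z ≤ M * qwInt q w x := fun z => (div_le_iff₀ hQ).1 (hbound x z)
  have hn0 : (0 : ℝ) < n := by exact_mod_cast hn
  have hq_int : Integrable (q x) := by
    by_contra h
    have := hq_prob x
    rw [integral_undef h] at this
    exact zero_ne_one this
  have hprod_int : Integrable fun ys : Fin (n - 1) → Rd d => ∏ i, q x (ys i) :=
    Integrable.fintype_prod fun _ => hq_int
  have hprod : (∫ ys : Fin (n - 1) → Rd d, ∏ i, q x (ys i)) = 1 := by
    have h := integral_fintype_prod_volume_eq_prod (ι := Fin (n - 1)) (fun _ => q x)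
    rw [h]
    simp [hq_prob x]
  have hsum_nonneg : ∀ ys : Fin (n - 1) → Rd d, 0 ≤ ∑ i, w x (ys i) :=
    fun ys => Finset.sum_nonneg fun i _ => (hw_pos x (ys i)).le
  have havg_pos : ∀ ys : Fin (n - 1) → Rd d, 0 < (w x y + ∑ i, w x (ys i)) / n := fun ys =>
    div_pos (add_pos_of_pos_of_nonneg (hw_pos x y) (hsum_nonneg ys)) hn0
  have havg_le : ∀ ys : Fin (n - 1) → Rd d,
      (w x y + ∑ i, w x (ys i)) / n ≤ M * qwInt q w x := fun ys => by
    rw [div_le_iff₀ hn0]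
    have h : ∑ i, w x (ys i) ≤ ∑ _i : Fin (n - 1), M * qwInt q w x :=
      Finset.sum_le_sum fun i _ => hw_le (ys i)
    rw [Finset.sum_const, Finset.card_univ, Fintype.card_fin, nsmul_eq_mul,
      Nat.cast_sub hn, Nat.cast_one] at h
    linarith [hw_le y]
  have hw_meas_x : Measurable (w x) := hw_meas.of_uncurry_left
  have hint : Integrable fun ys : Fin (n - 1) → Rd d =>
      ((w x y + ∑ i, w x (ys i)) / n)⁻¹ * ∏ i, q x (ys i) := by
    refine hprod_int.bdd_mul (c := (w x y / n)⁻¹) ?_ (.of_forall fun ys => ?_)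
    · exact Measurable.aestronglyMeasurable (by fun_prop)
    · rw [Real.norm_of_nonneg (inv_nonneg.2 (havg_pos ys).le)]
      have h := hsum_nonneg ys
      exact inv_anti₀ (div_pos (hw_pos x y) hn0) (by gcongr; linarith)
  rw [qtw, inv_inv]
  calc (M * qwInt q w x)⁻¹
      = ∫ ys : Fin (n - 1) → Rd d, (M * qwInt q w x)⁻¹ * ∏ i, q x (ys i) := by
        rw [integral_const_mul, hprod, mul_one]
    _ ≤ _ := by
        refine integral_mono (hprod_int.const_mul _) hint fun ys => ?_
        exact mul_le_mul_of_nonneg_right (inv_anti₀ (havg_pos ys) (havg_le ys))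
          (Finset.prod_nonneg fun i _ => (hq_pos x (ys i)).le)

/-- Dirichlet forms are monotone in the off-diagonal density, up to a constant factor. -/
theorem ofReal_mul_dform_le {d : ℕ} {pi : Rd d → ℝ} {p p' : Rd d → Rd d → ℝ}
    (hpi : ∀ x, 0 ≤ pi x) {c : ℝ} (hc : 0 ≤ c) (h : ∀ x y, c * p x y ≤ p' x y) (f : Rd d → ℝ) :
    ENNReal.ofReal c * dform pi p f ≤ dform pi p' f := by
  unfold dform
  rw [mul_left_comm, ← lintegral_const_mul' _ _ ofReal_ne_top]
  gcongr with x
  rw [← lintegral_const_mul' _ _ ofReal_ne_top]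
  gcongr with y
  rw [← ENNReal.ofReal_mul hc]
  apply ENNReal.ofReal_le_ofReal
  calc c * ((f x - f y) ^ 2 * p x y * pi x) = (f x - f y) ^ 2 * (c * p x y) * pi x := by ring
    _ ≤ _ := mul_le_mul_of_nonneg_right
        (mul_le_mul_of_nonneg_left (h x y) (sq_nonneg _)) (hpi x)

/-- If the importance weights `ϖ` are uniformly bounded by `M`, then
`ℰ(P̃ₙ, f) ≥ M⁻¹ ℰ(P_∞, f)` for every `n ≥ 1` and every `f ∈ L²(π)`. -/
theorem semi_ideal_vs_ideal_spi {d : ℕ}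
    (pi : Rd d → ℝ) (q w : Rd d → Rd d → ℝ)
    (hpi_meas : Measurable pi) (hpi_pos : ∀ x, 0 < pi x)
    (hpi_prob : (∫ x, pi x) = 1)
    (hq_meas : Measurable (Function.uncurry q)) (hq_pos : ∀ x y, 0 < q x y)
    (hq_prob : ∀ x, (∫ y, q x y) = 1)
    (hw_meas : Measurable (Function.uncurry w)) (hw_pos : ∀ x y, 0 < w x y)
    (hqw_int : ∀ x, Integrable fun y => q x y * w x y)
    (M : ℝ) (hM : 0 < M) (hbound : ∀ x y : Rd d, impW q w x y ≤ M)
    (n : ℕ) (hn : 1 ≤ n)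
    (f : Rd d → ℝ) (hf_meas : Measurable f)
    (hf2 : Integrable fun x => f x ^ 2 * pi x) :
    ENNReal.ofReal M⁻¹ * dform pi (pIdeal pi q w) f ≤
      dform pi (pSemi pi q w n) f := by
  refine ofReal_mul_dform_le (fun x => (hpi_pos x).le) (inv_nonneg.2 hM.le) (fun x y => ?_) f
  have hQx := qwInt_pos hq_pos hw_pos hqw_int x
  have hQy := qwInt_pos hq_pos hw_pos hqw_int y
  have hqtw : ∀ u v, (M * qwInt q w u)⁻¹ ≤ (qtw q w n u v)⁻¹ := fun u v =>
    inv_mul_qwInt_le_inv_qtw hq_pos hq_prob hw_meas hw_pos hqw_int hbound hn u v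
  have hr : 0 ≤ accRatio pi q w x y :=
    div_nonneg (mul_pos (mul_pos (hpi_pos y) (hq_pos y x)) (hw_pos y x)).le
      (mul_pos (mul_pos (hpi_pos x) (hq_pos x y)) (hw_pos x y)).le
  calc M⁻¹ * pIdeal pi q w x y
      = q x y * w x y * ((M * qwInt q w x)⁻¹ *
          min 1 (accRatio pi q w x y * qwInt q w x / qwInt q w y)) := by
        rw [pIdeal, mul_inv]
        ring
    _ = q x y * w x y * min (M * qwInt q w x)⁻¹
          (accRatio pi q w x y * (M * qwInt q w y)⁻¹) := by
        rw [mul_min_of_nonneg _ _ (inv_nonneg.2 (mul_pos hM hQx).le), mul_one]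
        congr 2
        field_simp
    _ ≤ pSemi pi q w n x y := by
        rw [pSemi, div_eq_mul_inv]
        exact mul_le_mul_of_nonneg_left
          (min_le_min (hqtw x y) (mul_le_mul_of_nonneg_left (hqtw y x) hr))
          (mul_pos (hq_pos x y) (hw_pos x y)).le

end
end

section
/- Suppose the importance weights are bounded above and below: there are 0 < m ≤ M < ∞ with m ≤ ϖ(x,y) ≤ M for all x, y ∈ ℝ^d. Then for every n ≥ 1 and every f ∈ L²₀(π) with ‖f‖_osc < ∞, ℰ(P̃_n, f) ≤ (M/m)² · ℰ(P_n, f). -/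
open MeasureTheory ENNReal Finset

noncomputable section

variable {d : ℕ}

/-- Averaging a measurable function with values in `[a, b]` against a probability density
gives a value in `[a, b]`. -/
theorem integral_mul_density_mem_Icc {α : Type*} [MeasurableSpace α] {μ : Measure α}
    {G ρ : α → ℝ} {a b : ℝ} (hG : Measurable G) (ha : ∀ t, a ≤ G t) (hb : ∀ t, G t ≤ b)
    (hρ : Integrable ρ μ) (hρ0 : ∀ t, 0 ≤ ρ t) (hρ1 : ∫ t, ρ t ∂μ = 1) :
    Integrable (fun t => G t * ρ t) μ ∧ ∫ t, G t * ρ t ∂μ ∈ Set.Icc a b := by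
  have hint : Integrable (fun t => G t * ρ t) μ := by
    refine hρ.bdd_mul (c := max |a| |b|) hG.aestronglyMeasurable (Filter.Eventually.of_forall ?_)
    intro t
    rw [Real.norm_eq_abs]
    exact abs_le_max_abs_abs (ha t) (hb t)
  refine ⟨hint, ?_, ?_⟩
  · calc a = ∫ t, a * ρ t ∂μ := by rw [integral_const_mul, hρ1, mul_one]
      _ ≤ _ := integral_mono (hρ.const_mul a) hint
          fun t => mul_le_mul_of_nonneg_right (ha t) (hρ0 t)
  · calc _ ≤ ∫ t, b * ρ t ∂μ := integral_mono hint (hρ.const_mul b)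
          fun t => mul_le_mul_of_nonneg_right (hb t) (hρ0 t)
      _ = b := by rw [integral_const_mul, hρ1, mul_one]

/-- The average of `n` numbers from `[a, b]`, one of them singled out, lies in `[a, b]`. -/
theorem average_mem_Icc {n : ℕ} (hn : 1 ≤ n) {a b v : ℝ} {u : Fin (n - 1) → ℝ}
    (hv : v ∈ Set.Icc a b) (hu : ∀ i, u i ∈ Set.Icc a b) :
    (v + ∑ i, u i) / n ∈ Set.Icc a b := by
  have hn' : (0 : ℝ) < n := by exact_mod_cast hn
  have hcast : ((n - 1 : ℕ) : ℝ) = n - 1 := by rw [Nat.cast_sub hn, Nat.cast_one]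
  have h1 : (n - 1 : ℝ) * a ≤ ∑ i, u i := by
    simpa [hcast] using Finset.card_nsmul_le_sum Finset.univ u a fun i _ => (hu i).1
  have h2 : ∑ i, u i ≤ (n - 1 : ℝ) * b := by
    simpa [hcast] using Finset.sum_le_card_nsmul Finset.univ u b fun i _ => (hu i).2
  constructor
  · rw [le_div_iff₀ hn']; linarith [hv.1]
  · rw [div_le_iff₀ hn']; linarith [hv.2]

/-- If the importance weights lie in `[m, M]`, the semi-ideal density is at most `M / m` times
the Multiple-try Metropolis density. -/
theorem pSemi_le_mul_pMTM {pi : Rd d → ℝ} {q w : Rd d → Rd d → ℝ}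
    (hpi_pos : ∀ x, 0 < pi x) (hq_pos : ∀ x y, 0 < q x y)
    (hq_prob : ∀ x, (∫ y, q x y) = 1)
    (hw_meas : Measurable (Function.uncurry w)) (hw_pos : ∀ x y, 0 < w x y)
    {m M : ℝ} (hm : 0 < m) (hmM : m ≤ M)
    (hlow : ∀ x y : Rd d, m ≤ impW q w x y) (hupp : ∀ x y : Rd d, impW q w x y ≤ M)
    {n : ℕ} (hn : 1 ≤ n) (x y : Rd d) :
    0 ≤ pMTM pi q w n x y ∧ pSemi pi q w n x y ≤ M / m * pMTM pi q w n x y := by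
  have hM : 0 < M := hm.trans_le hmM
  have hQ (x : Rd d) : 0 < qwInt q w x :=
    (div_pos_iff_of_pos_left (hw_pos x x)).1 (hm.trans_le (hlow x x))
  have hw_mem (x y : Rd d) : w x y ∈ Set.Icc (m * qwInt q w x) (M * qwInt q w x) :=
    ⟨(le_div_iff₀ (hQ x)).1 (hlow x y), (div_le_iff₀ (hQ x)).1 (hupp x y)⟩
  have hwx (x : Rd d) : Measurable (w x) := hw_meas.of_uncurry_left
  have hq_int (x : Rd d) : Integrable (q x) :=
    .of_integral_ne_zero (by rw [hq_prob x]; exact one_ne_zero)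
  have hρ (x : Rd d) : Integrable fun ys : Fin (n - 1) → Rd d => ∏ i, q x (ys i) :=
    Integrable.fintype_prod fun _ => hq_int x
  have hρ0 (x : Rd d) (ys : Fin (n - 1) → Rd d) : 0 ≤ ∏ i, q x (ys i) :=
    Finset.prod_nonneg fun i _ => (hq_pos x (ys i)).le
  have hρ1 (x : Rd d) : ∫ ys : Fin (n - 1) → Rd d, ∏ i, q x (ys i) = 1 := by
    rw [integral_fintype_prod_volume_eq_prod (fun _ => q x)]
    simp [hq_prob]
  have hA (x y : Rd d) (ys : Fin (n - 1) → Rd d) :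
      ((w x y + ∑ i, w x (ys i)) / n)⁻¹ ∈
        Set.Icc (M * qwInt q w x)⁻¹ (m * qwInt q w x)⁻¹ := by
    have h := average_mem_Icc hn (hw_mem x y) fun i => hw_mem x (ys i)
    have h0 := mul_pos hm (hQ x)
    exact ⟨inv_anti₀ (h0.trans_le h.1) h.2, inv_anti₀ h0 h.1⟩
  have hqtw (x y : Rd d) : (qtw q w n x y)⁻¹ ≤ (m * qwInt q w x)⁻¹ := by
    rw [qtw, inv_inv]
    exact (integral_mul_density_mem_Icc (by fun_prop) (fun ys => (hA x y ys).1)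
      (fun ys => (hA x y ys).2) (hρ x) (hρ0 x) (hρ1 x)).2.2
  have hr : 0 < accRatio pi q w x y :=
    div_pos (mul_pos (mul_pos (hpi_pos y) (hq_pos y x)) (hw_pos y x))
      (mul_pos (mul_pos (hpi_pos x) (hq_pos x y)) (hw_pos x y))
  set r := accRatio pi q w x y with hrdef
  set c := min (qwInt q w x)⁻¹ (r * (qwInt q w y)⁻¹) with hc
  have hc0 : 0 < c := lt_min (inv_pos.2 (hQ x)) (mul_pos hr (inv_pos.2 (hQ y)))
  have hsemi : min (qtw q w n x y)⁻¹ (r / qtw q w n y x) ≤ m⁻¹ * c := by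
    rw [hc, mul_min_of_nonneg _ _ (inv_pos.2 hm).le]
    refine min_le_min ?_ ?_
    · rw [← mul_inv]; exact hqtw x y
    · rw [div_eq_mul_inv, mul_left_comm, ← mul_inv]
      exact mul_le_mul_of_nonneg_left (hqtw y x) hr.le
  have hmtm : M⁻¹ * c ≤ ∫ ys : Fin (n - 1) → Rd d, ∫ zs : Fin (n - 1) → Rd d,
      min ((n : ℝ) / (w x y + ∑ i, w x (ys i))) (r * n / (w y x + ∑ i, w y (zs i))) *
        ((∏ i, q x (ys i)) * ∏ i, q y (zs i)) := by
    have key := integral_mul_density_mem_Icc (a := M⁻¹ * c) (b := (m * qwInt q w x)⁻¹)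
      (G := fun p : (Fin (n - 1) → Rd d) × (Fin (n - 1) → Rd d) =>
        min ((n : ℝ) / (w x y + ∑ i, w x (p.1 i))) (r * n / (w y x + ∑ i, w y (p.2 i))))
      (by fun_prop) ?_ ?_ ((hρ x).mul_prod (hρ y))
      (fun p => mul_nonneg (hρ0 x p.1) (hρ0 y p.2))
      ((integral_prod_mul (fun ys : Fin (n - 1) → Rd d => ∏ i, q x (ys i))
        (fun zs : Fin (n - 1) → Rd d => ∏ i, q y (zs i))).trans (by rw [hρ1, hρ1, one_mul]))
    · rw [integral_prod _ key.1] at key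
      exact key.2.1
    · intro p
      rw [hc, mul_min_of_nonneg _ _ (inv_pos.2 hM).le]
      refine min_le_min ?_ ?_
      · rw [← mul_inv, ← inv_div]; exact (hA x y p.1).1
      · rw [mul_left_comm, ← mul_inv, mul_div_assoc, ← inv_div]
        exact mul_le_mul_of_nonneg_left (hA y x p.2).1 hr.le
    · intro p
      refine (min_le_left _ _).trans ?_
      rw [← inv_div]
      exact (hA x y p.1).2
  have hqw : 0 ≤ q x y * w x y := (mul_pos (hq_pos x y) (hw_pos x y)).le
  refine ⟨mul_nonneg hqw ((mul_pos (inv_pos.2 hM) hc0).le.trans hmtm), ?_⟩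
  rw [pSemi, pMTM, mul_left_comm, ← hrdef]
  refine mul_le_mul_of_nonneg_left (hsemi.trans ?_) hqw
  calc m⁻¹ * c = M / m * (M⁻¹ * c) := by field_simp
    _ ≤ _ := mul_le_mul_of_nonneg_left hmtm (div_pos hM hm).le

/-- A pointwise comparison of transition densities gives a comparison of Dirichlet forms. -/
theorem dform_le_mul_dform {pi : Rd d → ℝ} (hpi : ∀ x, 0 ≤ pi x) {p p' : Rd d → Rd d → ℝ}
    {C : ℝ} (hC : 0 ≤ C) (h : ∀ x y, p x y ≤ C * p' x y) (f : Rd d → ℝ) :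
    dform pi p f ≤ ENNReal.ofReal C * dform pi p' f := by
  rw [dform, dform, mul_left_comm, ← lintegral_const_mul' _ _ ofReal_ne_top]
  gcongr with x
  rw [← lintegral_const_mul' _ _ ofReal_ne_top]
  gcongr with y
  rw [← ENNReal.ofReal_mul hC]
  refine ENNReal.ofReal_le_ofReal ?_
  calc (f x - f y) ^ 2 * p x y * pi x ≤ (f x - f y) ^ 2 * (C * p' x y) * pi x :=
        mul_le_mul_of_nonneg_right (mul_le_mul_of_nonneg_left (h x y) (sq_nonneg _)) (hpi x)
    _ = C * ((f x - f y) ^ 2 * p' x y * pi x) := by ring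

/-- If the importance weights satisfy `m ≤ ϖ ≤ M`, then
`ℰ(P̃ₙ,f) ≤ (M/m)² ℰ(Pₙ,f)` for every `n ≥ 1` and `f ∈ L²₀(π)` with finite
oscillation. -/
theorem semi_ideal_vs_mtm_spi {d : ℕ}
    (pi : Rd d → ℝ) (q w : Rd d → Rd d → ℝ)
    (hpi_meas : Measurable pi) (hpi_pos : ∀ x, 0 < pi x)
    (hpi_prob : (∫ x, pi x) = 1)
    (hq_meas : Measurable (Function.uncurry q)) (hq_pos : ∀ x y, 0 < q x y)
    (hq_prob : ∀ x, (∫ y, q x y) = 1)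
    (hw_meas : Measurable (Function.uncurry w)) (hw_pos : ∀ x y, 0 < w x y)
    (hqw_int : ∀ x, Integrable fun y => q x y * w x y)
    (m M : ℝ) (hm : 0 < m) (hmM : m ≤ M)
    (hlow : ∀ x y : Rd d, m ≤ impW q w x y)
    (hupp : ∀ x y : Rd d, impW q w x y ≤ M)
    (n : ℕ) (hn : 1 ≤ n)
    (f : Rd d → ℝ) (hf_meas : Measurable f)
    (hf2 : Integrable fun x => f x ^ 2 * pi x)
    (hf0 : (∫ x, f x * pi x) = 0)
    (hosc : oscSeminorm pi f < ∞) :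
    dform pi (pSemi pi q w n) f ≤
      ENNReal.ofReal ((M / m) ^ 2) * dform pi (pMTM pi q w n) f := by
  refine dform_le_mul_dform (fun x => (hpi_pos x).le) (sq_nonneg _) (fun x y => ?_) f
  obtain ⟨h0, h⟩ := pSemi_le_mul_pMTM hpi_pos hq_pos hq_prob hw_meas hw_pos hm hmM hlow hupp hn x y
  exact h.trans (mul_le_mul_of_nonneg_right
    (le_self_pow₀ ((one_le_div hm).2 hmM) two_ne_zero) h0)

end
end

section
/- For every n ≥ 1, every s > 0, and every f ∈ L²₀(π) with ‖f‖_osc < ∞, ℰ(P̃_n, f) ≤ s·ℰ(P_n, f) + β_{2,n}(s)·‖f‖_osc², where β_{2,n}(s) := ∫∫ 1{ ζ_n(x,y) ≤ 1/s } p̃_n(x,y) π(x) dx dy and ζ_n(x,y) := ∫_{(ℝ^d)^{n−1}} ∫_{(ℝ^d)^{n−1}} min{ (q̃w)_n(x,y)·n/(w(x,y) + Σ_{i=2}^n w(x,y_i)), (q̃w)_n(y,x)·n/(w(y,x) + Σ_{i=2}^n w(y,z_i)) } Π_{i=2}^n q(x,y_i) dy_i Π_{i=2}^n q(y,z_i)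 dz_i. -/
open MeasureTheory ENNReal Finset

noncomputable section

variable {d : ℕ}

/-- `ζₙ(x,y)`, the conditional expectation of the minimum of the two normalisation
ratios appearing in the Multiple-try acceptance probability. -/
def zetaFun (q w : Rd d → Rd d → ℝ) (n : ℕ) (x y : Rd d) : ℝ :=
  ∫ ys : Fin (n - 1) → Rd d, ∫ zs : Fin (n - 1) → Rd d,
    min (qtw q w n x y * n / (w x y + ∑ i, w x (ys i)))
        (qtw q w n y x * n / (w y x + ∑ i, w y (zs i))) *
      ((∏ i, q x (ys i)) * ∏ i, q y (zs i))

/-- `β₂ₙ(s) = ∫∫ 1{ζₙ(x,y) ≤ 1/s} p̃ₙ(x,y) π(x) dx dy`. -/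
def beta2 (pi : Rd d → ℝ) (q w : Rd d → Rd d → ℝ) (n : ℕ) (s : ℝ) : ℝ≥0∞ :=
  ∫⁻ x, ∫⁻ y,
    if zetaFun q w n x y ≤ 1 / s then
      ENNReal.ofReal (pSemi pi q w n x y * pi x)
    else 0

lemma integrable_prod_density {q : Rd d → Rd d → ℝ} (hq_prob : ∀ x, (∫ y, q x y) = 1)
    (m : ℕ) (x : Rd d) : Integrable fun ys : Fin m → Rd d => ∏ i, q x (ys i) :=
  Integrable.fintype_prod fun _ =>
    integrable_of_integral_eq_one (hq_prob x)

lemma measurable_sum_weights {w : Rd d → Rd d → ℝ} (hw_meas : Measurable (Function.uncurry w))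
    (m : ℕ) : Measurable fun p : (Rd d × Rd d) × (Fin m → Rd d) =>
      w p.1.1 p.1.2 + ∑ i, w p.1.1 (p.2 i) := by
  refine Measurable.add (hw_meas.comp (by fun_prop : Measurable
    fun p : (Rd d × Rd d) × (Fin m → Rd d) => (p.1.1, p.1.2))) ?_
  refine Finset.measurable_fun_sum _ fun i _ => ?_
  exact hw_meas.comp (by fun_prop : Measurable
    fun p : (Rd d × Rd d) × (Fin m → Rd d) => (p.1.1, p.2 i))

lemma measurable_prod_density {q : Rd d → Rd d → ℝ} (hq_meas : Measurable (Function.uncurry q))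
    (m : ℕ) : Measurable fun p : Rd d × (Fin m → Rd d) => ∏ i, q p.1 (p.2 i) :=
  Finset.measurable_fun_prod _ fun i _ => hq_meas.comp (by fun_prop : Measurable
    fun p : Rd d × (Fin m → Rd d) => (p.1, p.2 i))

lemma le_sum_weights {w : Rd d → Rd d → ℝ} (hw_pos : ∀ x y, 0 < w x y) {m : ℕ} (x y : Rd d)
    (ys : Fin m → Rd d) : w x y ≤ w x y + ∑ i, w x (ys i) :=
  le_add_of_nonneg_right (Finset.sum_nonneg fun _ _ => (hw_pos _ _).le)

lemma sum_weights_pos {w : Rd d → Rd d → ℝ} (hw_pos : ∀ x y, 0 < w x y) {m : ℕ} (x y : Rd d)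
    (ys : Fin m → Rd d) : 0 < w x y + ∑ i, w x (ys i) :=
  (hw_pos x y).trans_le (le_sum_weights hw_pos x y ys)

lemma qtw_pos {q w : Rd d → Rd d → ℝ}
    (hq_pos : ∀ x y, 0 < q x y) (hq_prob : ∀ x, (∫ y, q x y) = 1)
    (hw_meas : Measurable (Function.uncurry w)) (hw_pos : ∀ x y, 0 < w x y)
    {n : ℕ} (hn : 1 ≤ n) (x y : Rd d) : 0 < qtw q w n x y := by
  have hn' : (0 : ℝ) < n := by exact_mod_cast hn
  have hpos : ∀ ys : Fin (n - 1) → Rd d,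
      0 < ((w x y + ∑ i, w x (ys i)) / n)⁻¹ * ∏ i, q x (ys i) := fun ys =>
    mul_pos (inv_pos.2 (div_pos (sum_weights_pos hw_pos x y ys) hn'))
      (Finset.prod_pos fun _ _ => hq_pos _ _)
  have hint : Integrable fun ys : Fin (n - 1) → Rd d =>
      ((w x y + ∑ i, w x (ys i)) / n)⁻¹ * ∏ i, q x (ys i) := by
    refine (integrable_prod_density hq_prob (n - 1) x).bdd_mul (c := (w x y / n)⁻¹) ?_ ?_
    · exact ((((measurable_sum_weights hw_meas (n - 1)).comp
        (measurable_prodMk_left (x := (x, y)))).div_const _).inv).aestronglyMeasurable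
    · refine Filter.Eventually.of_forall fun ys => ?_
      rw [Real.norm_of_nonneg (inv_pos.2 (div_pos (sum_weights_pos hw_pos x y ys) hn')).le]
      have := hw_pos x y
      have := le_sum_weights hw_pos x y ys
      gcongr
  refine inv_pos.2 ((integral_pos_iff_support_of_nonneg (fun ys => (hpos ys).le) hint).2 ?_)
  rw [Set.eq_univ_of_forall (s := Function.support _) fun ys => (hpos ys).ne']
  exact isOpen_univ.measure_pos _ Set.univ_nonempty

/-- The integrand of `pMTM`, as a function of all its variables. -/
def mtmIntegrand (pi : Rd d → ℝ) (q w : Rd d → Rd d → ℝ) (n : ℕ)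
    (p : ((Rd d × Rd d) × (Fin (n - 1) → Rd d)) × (Fin (n - 1) → Rd d)) : ℝ :=
  min ((n : ℝ) / (w p.1.1.1 p.1.1.2 + ∑ i, w p.1.1.1 (p.1.2 i)))
      (accRatio pi q w p.1.1.1 p.1.1.2 * n / (w p.1.1.2 p.1.1.1 + ∑ i, w p.1.1.2 (p.2 i))) *
    ((∏ i, q p.1.1.1 (p.1.2 i)) * ∏ i, q p.1.1.2 (p.2 i))

lemma measurable_accRatio {pi : Rd d → ℝ} {q w : Rd d → Rd d → ℝ} (hpi_meas : Measurable pi)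
    (hq_meas : Measurable (Function.uncurry q)) (hw_meas : Measurable (Function.uncurry w)) :
    Measurable fun p : Rd d × Rd d => accRatio pi q w p.1 p.2 := by
  have hq' := hq_meas.comp measurable_swap
  have hw' := hw_meas.comp measurable_swap
  exact (((hpi_meas.comp measurable_snd).mul hq').mul hw').div
    (((hpi_meas.comp measurable_fst).mul hq_meas).mul hw_meas)

lemma measurable_mtmIntegrand {pi : Rd d → ℝ} {q w : Rd d → Rd d → ℝ} (hpi_meas : Measurable pi)
    (hq_meas : Measurable (Function.uncurry q)) (hw_meas : Measurable (Function.uncurry w))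
    (n : ℕ) : Measurable (mtmIntegrand pi q w n) := by
  unfold mtmIntegrand
  refine Measurable.mul (Measurable.min (Measurable.div measurable_const ?_)
    (Measurable.div (Measurable.mul ?_ measurable_const) ?_)) (Measurable.mul ?_ ?_)
  · exact (measurable_sum_weights hw_meas (n - 1)).comp measurable_fst
  · exact (measurable_accRatio hpi_meas hq_meas hw_meas).comp
      (measurable_fst.comp measurable_fst)
  · exact (measurable_sum_weights hw_meas (n - 1)).comp (by fun_prop : Measurable
      fun p : ((Rd d × Rd d) × (Fin (n - 1) → Rd d)) × (Fin (n - 1) → Rd d) =>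
        ((p.1.1.2, p.1.1.1), p.2))
  · exact (measurable_prod_density hq_meas (n - 1)).comp (by fun_prop : Measurable
      fun p : ((Rd d × Rd d) × (Fin (n - 1) → Rd d)) × (Fin (n - 1) → Rd d) =>
        (p.1.1.1, p.1.2))
  · exact (measurable_prod_density hq_meas (n - 1)).comp (by fun_prop : Measurable
      fun p : ((Rd d × Rd d) × (Fin (n - 1) → Rd d)) × (Fin (n - 1) → Rd d) =>
        (p.1.1.2, p.2))

lemma measurable_pMTM {pi : Rd d → ℝ} {q w : Rd d → Rd d → ℝ} (hpi_meas : Measurable pi)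
    (hq_meas : Measurable (Function.uncurry q)) (hw_meas : Measurable (Function.uncurry w))
    (n : ℕ) : Measurable fun p : Rd d × Rd d => pMTM pi q w n p.1 p.2 := by
  have h := (measurable_mtmIntegrand hpi_meas hq_meas hw_meas n).stronglyMeasurable
  exact (hq_meas.mul hw_meas).mul
    (h.integral_prod_right'.integral_prod_right' (ν := volume)).measurable

lemma accRatio_pos {pi : Rd d → ℝ} {q w : Rd d → Rd d → ℝ} (hpi_pos : ∀ x, 0 < pi x)
    (hq_pos : ∀ x y, 0 < q x y) (hw_pos : ∀ x y, 0 < w x y) (x y : Rd d) :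
    0 < accRatio pi q w x y := by
  have h := fun x y => mul_pos (mul_pos (hpi_pos x) (hq_pos x y)) (hw_pos x y)
  exact div_pos (h y x) (h x y)

lemma pSemi_nonneg {pi : Rd d → ℝ} {q w : Rd d → Rd d → ℝ} (hpi_pos : ∀ x, 0 < pi x)
    (hq_pos : ∀ x y, 0 < q x y) (hq_prob : ∀ x, (∫ y, q x y) = 1)
    (hw_meas : Measurable (Function.uncurry w)) (hw_pos : ∀ x y, 0 < w x y)
    {n : ℕ} (hn : 1 ≤ n) (x y : Rd d) : 0 ≤ pSemi pi q w n x y := by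
  have hQ := qtw_pos hq_pos hq_prob hw_meas hw_pos hn
  exact mul_nonneg (mul_pos (hq_pos x y) (hw_pos x y)).le
    (le_min (inv_pos.2 (hQ x y)).le
      (div_pos (accRatio_pos hpi_pos hq_pos hw_pos x y) (hQ y x)).le)

/-- The Multiple-try density dominates `ζₙ` times the semi-ideal density. -/
lemma pSemi_mul_zetaFun_le_pMTM {pi : Rd d → ℝ} {q w : Rd d → Rd d → ℝ}
    (hpi_meas : Measurable pi) (hpi_pos : ∀ x, 0 < pi x)
    (hq_meas : Measurable (Function.uncurry q)) (hq_pos : ∀ x y, 0 < q x y)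
    (hq_prob : ∀ x, (∫ y, q x y) = 1)
    (hw_meas : Measurable (Function.uncurry w)) (hw_pos : ∀ x y, 0 < w x y)
    {n : ℕ} (hn : 1 ≤ n) (x y : Rd d) :
    pSemi pi q w n x y * zetaFun q w n x y ≤ pMTM pi q w n x y := by
  have hn' : (0 : ℝ) < n := by exact_mod_cast hn
  have hr := accRatio_pos hpi_pos hq_pos hw_pos x y
  have hQx := qtw_pos hq_pos hq_prob hw_meas hw_pos hn x y
  have hQy := qtw_pos hq_pos hq_prob hw_meas hw_pos hn y x
  have hWx := sum_weights_pos hw_pos (m := n - 1) x y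
  have hWy := sum_weights_pos hw_pos (m := n - 1) y x
  have hprod : ∀ x (ys : Fin (n - 1) → Rd d), 0 < ∏ i, q x (ys i) := fun x ys =>
    Finset.prod_pos fun _ _ => hq_pos _ _
  have hmeas := measurable_mtmIntegrand hpi_meas hq_meas hw_meas n
  set m := min (qtw q w n x y)⁻¹ (accRatio pi q w x y / qtw q w n y x) with hm
  have hm0 : 0 ≤ m := le_min (inv_pos.2 hQx).le (div_pos hr hQy).le
  have hbound : ∀ ys zs : Fin (n - 1) → Rd d,
      ‖mtmIntegrand pi q w n (((x, y), ys), zs)‖ ≤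
        (n : ℝ) / w x y * ((∏ i, q x (ys i)) * ∏ i, q y (zs i)) := by
    intro ys zs
    have h1 := hWx ys
    have h2 := hWy zs
    have h3 := mul_pos (hprod x ys) (hprod y zs)
    have h4 := le_sum_weights hw_pos x y ys
    have h5 := hw_pos x y
    rw [mtmIntegrand, Real.norm_of_nonneg
      (mul_nonneg (le_min (by positivity) (by positivity)) h3.le)]
    exact mul_le_mul_of_nonneg_right ((min_le_left _ _).trans (by gcongr)) h3.le
  have hint : Integrable fun p : (Fin (n - 1) → Rd d) × (Fin (n - 1) → Rd d) =>
      mtmIntegrand pi q w n (((x, y), p.1), p.2) := by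
    refine Integrable.mono' (((integrable_prod_density hq_prob (n - 1) x).mul_prod
      (integrable_prod_density hq_prob (n - 1) y)).const_mul ((n : ℝ) / w x y)) ?_
      (Filter.Eventually.of_forall fun p => hbound p.1 p.2)
    exact (hmeas.comp (by fun_prop : Measurable
      fun p : (Fin (n - 1) → Rd d) × (Fin (n - 1) → Rd d) =>
        (((x, y), p.1), p.2))).aestronglyMeasurable
  have hint' : ∀ ys, Integrable fun zs : Fin (n - 1) → Rd d =>
      mtmIntegrand pi q w n (((x, y), ys), zs) := by
    intro ys
    refine Integrable.mono' (((integrable_prod_density hq_prob (n - 1) y).const_mul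
      (∏ i, q x (ys i))).const_mul ((n : ℝ) / w x y)) ?_
      (Filter.Eventually.of_forall fun zs => hbound ys zs)
    exact (hmeas.comp (measurable_prodMk_left (x := ((x, y), ys)))).aestronglyMeasurable
  have hpoint : ∀ ys zs : Fin (n - 1) → Rd d,
      m * (min (qtw q w n x y * n / (w x y + ∑ i, w x (ys i)))
        (qtw q w n y x * n / (w y x + ∑ i, w y (zs i))) *
          ((∏ i, q x (ys i)) * ∏ i, q y (zs i))) ≤
        mtmIntegrand pi q w n (((x, y), ys), zs) := by
    intro ys zs
    have h1 := hWx ys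
    have h2 := hWy zs
    rw [mtmIntegrand, ← mul_assoc]
    refine mul_le_mul_of_nonneg_right (le_min ?_ ?_) (mul_pos (hprod x ys) (hprod y zs)).le
    · calc _ ≤ (qtw q w n x y)⁻¹ * (qtw q w n x y * n / (w x y + ∑ i, w x (ys i))) :=
            mul_le_mul (min_le_left _ _) (min_le_left _ _)
              (le_min (by positivity) (by positivity)) (by positivity)
        _ = _ := by field_simp
    · calc _ ≤ (accRatio pi q w x y / qtw q w n y x) *
              (qtw q w n y x * n / (w y x + ∑ i, w y (zs i))) :=
            mul_le_mul (min_le_right _ _) (min_le_right _ _)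
              (le_min (by positivity) (by positivity)) (by positivity)
        _ = _ := by field_simp
  have hnonneg : ∀ ys zs : Fin (n - 1) → Rd d,
      0 ≤ m * (min (qtw q w n x y * n / (w x y + ∑ i, w x (ys i)))
        (qtw q w n y x * n / (w y x + ∑ i, w y (zs i))) *
          ((∏ i, q x (ys i)) * ∏ i, q y (zs i))) := by
    intro ys zs
    have h1 := hWx ys
    have h2 := hWy zs
    have h3 := mul_pos (hprod x ys) (hprod y zs)
    exact mul_nonneg hm0 (mul_nonneg (le_min (by positivity) (by positivity)) h3.le)
  rw [pSemi, pMTM, mul_assoc, ← hm]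
  refine mul_le_mul_of_nonneg_left ?_ (mul_pos (hq_pos x y) (hw_pos x y)).le
  rw [zetaFun, ← integral_const_mul]
  simp_rw [← integral_const_mul]
  exact integral_mono_of_nonneg
    (Filter.Eventually.of_forall fun ys => integral_nonneg (hnonneg ys)) hint.integral_prod_left
    (Filter.Eventually.of_forall fun ys => integral_mono_of_nonneg
      (Filter.Eventually.of_forall (hnonneg ys)) (hint' ys)
      (Filter.Eventually.of_forall (hpoint ys)))

lemma ae_sq_sub_le_oscSeminorm_sq {pi : Rd d → ℝ} (hpi_meas : Measurable pi)
    (hpi_pos : ∀ x, 0 < pi x) (f : Rd d → ℝ) :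
    ∀ᵐ x, ∀ᵐ y, ENNReal.ofReal ((f x - f y) ^ 2) ≤ oscSeminorm pi f ^ 2 := by
  have hac : (volume : Measure (Rd d)) ≪ piMeasure pi :=
    withDensity_absolutelyContinuous' hpi_meas.ennreal_ofReal.aemeasurable
      (Filter.Eventually.of_forall fun x => (ENNReal.ofReal_pos.2 (hpi_pos x)).ne')
  have : SFinite (piMeasure pi) := by unfold piMeasure; infer_instance
  have h1 : ∀ᵐ p ∂(volume : Measure (Rd d)).prod volume,
      ENNReal.ofReal (f p.1 - f p.2) ≤ oscSeminorm pi f :=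
    (hac.prod hac).ae_le (ENNReal.ae_le_essSup _)
  have h2 : ∀ᵐ p ∂(volume : Measure (Rd d)).prod volume,
      ENNReal.ofReal (f p.2 - f p.1) ≤ oscSeminorm pi f :=
    (Measure.measurePreserving_swap (μ := (volume : Measure (Rd d)))
      (ν := (volume : Measure (Rd d)))).quasiMeasurePreserving.ae h1
  refine Measure.ae_ae_of_ae_prod (μ := volume) (ν := volume)
    (p := fun p => ENNReal.ofReal ((f p.1 - f p.2) ^ 2) ≤ oscSeminorm pi f ^ 2) ?_
  filter_upwards [h1, h2] with p hp1 hp2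
  rw [← sq_abs, ENNReal.ofReal_pow (abs_nonneg _)]
  gcongr
  rcases abs_cases (f p.1 - f p.2) with h | h
  · rwa [h.1]
  · rwa [h.1, neg_sub]

/-- Weak Poincaré comparison between the semi-ideal kernel `P̃ₙ` and the
Multiple-try kernel `Pₙ`: `ℰ(P̃ₙ,f) ≤ s ℰ(Pₙ,f) + β₂ₙ(s) ‖f‖_osc²`. -/
theorem semi_ideal_vs_mtm_wpi {d : ℕ}
    (pi : Rd d → ℝ) (q w : Rd d → Rd d → ℝ)
    (hpi_meas : Measurable pi) (hpi_pos : ∀ x, 0 < pi x)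
    (hpi_prob : (∫ x, pi x) = 1)
    (hq_meas : Measurable (Function.uncurry q)) (hq_pos : ∀ x y, 0 < q x y)
    (hq_prob : ∀ x, (∫ y, q x y) = 1)
    (hw_meas : Measurable (Function.uncurry w)) (hw_pos : ∀ x y, 0 < w x y)
    (hqw_int : ∀ x, Integrable fun y => q x y * w x y)
    (n : ℕ) (hn : 1 ≤ n) (s : ℝ) (hs : 0 < s)
    (f : Rd d → ℝ) (hf_meas : Measurable f)
    (hf2 : Integrable fun x => f x ^ 2 * pi x)
    (hf0 : (∫ x, f x * pi x) = 0)
    (hosc : oscSeminorm pi f < ∞) :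
    dform pi (pSemi pi q w n) f ≤
      ENNReal.ofReal s * dform pi (pMTM pi q w n) f +
        beta2 pi q w n s * (oscSeminorm pi f) ^ 2 := by
  set O := oscSeminorm pi f with hO
  set A : Rd d → Rd d → ℝ≥0∞ := fun x y =>
    ENNReal.ofReal ((f x - f y) ^ 2 * pMTM pi q w n x y * pi x) with hA
  set B : Rd d → Rd d → ℝ≥0∞ := fun x y =>
    if zetaFun q w n x y ≤ 1 / s then ENNReal.ofReal (pSemi pi q w n x y * pi x) else 0 with hB
  have hAmeas : Measurable (Function.uncurry A) :=
    (((((hf_meas.comp measurable_fst).sub (hf_meas.comp measurable_snd)).pow_const 2).mul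
      (measurable_pMTM hpi_meas hq_meas hw_meas n)).mul
        (hpi_meas.comp measurable_fst)).ennreal_ofReal
  have hpoint : ∀ x y, ENNReal.ofReal ((f x - f y) ^ 2) ≤ O ^ 2 →
      ENNReal.ofReal ((f x - f y) ^ 2 * pSemi pi q w n x y * pi x) ≤
        ENNReal.ofReal s * A x y + O ^ 2 * B x y := by
    intro x y hxy
    have hp := pSemi_nonneg hpi_pos hq_pos hq_prob hw_meas hw_pos hn x y
    have hle := pSemi_mul_zetaFun_le_pMTM hpi_meas hpi_pos hq_meas hq_pos hq_prob hw_meas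
      hw_pos hn x y
    by_cases hz : zetaFun q w n x y ≤ 1 / s
    · refine le_add_left ?_
      simp only [hB, if_pos hz]
      rw [mul_assoc, ENNReal.ofReal_mul (sq_nonneg _)]
      gcongr
    · refine le_add_right ?_
      rw [hA, ← ENNReal.ofReal_mul hs.le]
      refine ENNReal.ofReal_le_ofReal ?_
      have hsz : 1 ≤ s * zetaFun q w n x y := by
        rw [not_le, div_lt_iff₀' hs] at hz
        exact hz.le
      have hsp : pSemi pi q w n x y ≤ s * pMTM pi q w n x y := by
        nlinarith [mul_le_mul_of_nonneg_left hsz hp, mul_le_mul_of_nonneg_left hle hs.le]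
      have := (hpi_pos x).le
      calc _ ≤ (f x - f y) ^ 2 * (s * pMTM pi q w n x y) * pi x := by gcongr
        _ = _ := by ring
  have hO2 : O ^ 2 ≠ ∞ := ENNReal.pow_ne_top hosc.ne
  have hmain : ∫⁻ x, ∫⁻ y, ENNReal.ofReal ((f x - f y) ^ 2 * pSemi pi q w n x y * pi x) ≤
      ENNReal.ofReal s * (∫⁻ x, ∫⁻ y, A x y) + O ^ 2 * ∫⁻ x, ∫⁻ y, B x y := by
    calc _ ≤ ∫⁻ x, ∫⁻ y, (ENNReal.ofReal s * A x y + O ^ 2 * B x y) := by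
          refine lintegral_mono_ae ?_
          filter_upwards [ae_sq_sub_le_oscSeminorm_sq hpi_meas hpi_pos f] with x hx
          refine lintegral_mono_ae ?_
          filter_upwards [hx] with y hxy using hpoint x y hxy
      _ = ∫⁻ x, (ENNReal.ofReal s * (∫⁻ y, A x y) + O ^ 2 * ∫⁻ y, B x y) := by
          refine lintegral_congr fun x => ?_
          rw [lintegral_add_left (hAmeas.of_uncurry_left.const_mul _),
            lintegral_const_mul' _ _ ENNReal.ofReal_ne_top, lintegral_const_mul' _ _ hO2]
      _ = _ := by
          have hA' : Measurable fun x => ∫⁻ y, A x y := hAmeas.lintegral_prod_right'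
          rw [lintegral_add_left (hA'.const_mul _),
            lintegral_const_mul' _ _ ENNReal.ofReal_ne_top, lintegral_const_mul' _ _ hO2]
  have hhalf : (1 / 2 : ℝ≥0∞) ≤ 1 := by
    rw [one_div]; exact ENNReal.inv_le_one.2 one_le_two
  calc dform pi (pSemi pi q w n) f
      ≤ 1 / 2 * (ENNReal.ofReal s * (∫⁻ x, ∫⁻ y, A x y) + O ^ 2 * ∫⁻ x, ∫⁻ y, B x y) :=
        mul_le_mul_right hmain _
    _ = ENNReal.ofReal s * dform pi (pMTM pi q w n) f +
          1 / 2 * (beta2 pi q w n s * O ^ 2) := by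
        rw [dform, beta2, mul_add, mul_left_comm, mul_comm (O ^ 2)]
    _ ≤ _ := by
        exact add_le_add_right (mul_le_of_le_one_left' hhalf) _

end
end

section
/- Let d ≥ 1, σ > 0, θ ≥ 0, set ρ := 1/(1+θσ²), and let g(x,y) be the density at y of N(ρx, σ²ρ·I_d). Let π be the standard Gaussian density on ℝ^d, define the acceptance probability α(x,y) := min{1, π(y)·g(y,x)/(π(x)·g(x,y))} and the average acceptance ᾱ(x) := ∫ g(x,y)·α(x,y) dy. Then the Metropolis–Hastings kernel with proposal density g and acceptance α is a positive operator on L²(π): for every f ∈ L²(π), ∫∫ π(x)·g(x,y)·α(x,y)·f(x)·f(y) dy dx + ∫ π(x)·(1 − ᾱ(x))·f(x)² dx ≥ 0 (all integrals being well defined). -/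
open MeasureTheory ENNReal

noncomputable section

/-- `ℝ^d` with the Euclidean norm and Lebesgue measure. -/
abbrev Ed (d : ℕ) := EuclideanSpace ℝ (Fin d)

variable {d : ℕ}

/-- The density at `y` of the Gaussian distribution `N(m, v·I_d)` on `ℝ^d`. -/
def gaussDens (m : Ed d) (v : ℝ) (y : Ed d) : ℝ :=
  (2 * Real.pi * v) ^ (-(d : ℝ) / 2) * Real.exp (-‖y - m‖ ^ 2 / (2 * v))

/-- The standard Gaussian density on `ℝ^d`. -/
def stdGauss (d : ℕ) (x : Ed d) : ℝ :=
  (2 * Real.pi) ^ (-(d : ℝ) / 2) * Real.exp (-‖x‖ ^ 2 / 2)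

/-- The proposal density `g(x,y)`: the density at `y` of `N(ρx, σ²ρ·I_d)` with
`ρ = 1/(1+θσ²)`. -/
def propDens (σ θ : ℝ) (x y : Ed d) : ℝ :=
  gaussDens ((1 / (1 + θ * σ ^ 2)) • x) (σ ^ 2 * (1 / (1 + θ * σ ^ 2))) y

/-- The Metropolis–Hastings acceptance probability
`α(x,y) = min{1, π(y) g(y,x)/(π(x) g(x,y))}`. -/
def alphaMH (σ θ : ℝ) (x y : Ed d) : ℝ :=
  min 1 (stdGauss d y * propDens σ θ y x / (stdGauss d x * propDens σ θ x y))

/-- The average acceptance probability `ᾱ(x) = ∫ g(x,y) α(x,y) dy`. -/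
def abarMH (d : ℕ) (σ θ : ℝ) (x : Ed d) : ℝ :=
  ∫ y : Ed d, propDens σ θ x y * alphaMH σ θ x y

/-- A kernel that is a nonnegative superposition of the rank-one kernels `φ ω x * φ ω y` is a
positive operator. -/
theorem integral_kernel_nonneg {X Ω : Type*} [MeasurableSpace X] [MeasurableSpace Ω]
    {μ : Measure X} {ν : Measure Ω} [SFinite μ] [SFinite ν] {φ : Ω → X → ℝ} {k : X → X → ℝ}
    {f : X → ℝ} {c : ℝ} (hc : 0 ≤ c) (hφ : Measurable fun p : Ω × X => φ p.1 p.2)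
    (hφ0 : ∀ ω x, 0 ≤ φ ω x) (hf : Measurable f)
    (hφi : ∀ x y, Integrable (fun ω => φ ω x * φ ω y) ν)
    (hk : ∀ x y, k x y = c * ∫ ω, φ ω x * φ ω y ∂ν)
    (hki : Integrable (fun p : X × X => k p.1 p.2 * f p.1 * f p.2) (μ.prod μ)) :
    0 ≤ ∫ x, ∫ y, k x y * f x * f y ∂μ ∂μ := by
  have hmeas : Measurable fun q : (X × X) × Ω =>
      c * ((φ q.2 q.1.1 * f q.1.1) * (φ q.2 q.1.2 * f q.1.2)) := by
    have h₁ : Measurable fun q : (X × X) × Ω => φ q.2 q.1.1 :=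
      hφ.comp (measurable_snd.prodMk (measurable_fst.comp measurable_fst))
    have h₂ : Measurable fun q : (X × X) × Ω => φ q.2 q.1.2 :=
      hφ.comp (measurable_snd.prodMk (measurable_snd.comp measurable_fst))
    fun_prop
  have hint : Integrable (fun q : (X × X) × Ω =>
      c * ((φ q.2 q.1.1 * f q.1.1) * (φ q.2 q.1.2 * f q.1.2))) ((μ.prod μ).prod ν) := by
    refine (integrable_prod_iff hmeas.aestronglyMeasurable).2 ⟨.of_forall fun p => ?_, ?_⟩
    · convert (hφi p.1 p.2).const_mul (c * f p.1 * f p.2) using 2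
      ring
    · convert hki.norm using 2 with p
      rw [hk, norm_mul, norm_mul, norm_mul, Real.norm_of_nonneg hc, Real.norm_of_nonneg
        (integral_nonneg fun ω => mul_nonneg (hφ0 ω _) (hφ0 ω _)), ← integral_const_mul,
        ← integral_mul_const, ← integral_mul_const]
      refine integral_congr_ae (.of_forall fun ω => ?_)
      simp only [norm_mul, Real.norm_of_nonneg hc, Real.norm_of_nonneg (hφ0 ω _)]
      ring
  have hrw : ∫ x, ∫ y, k x y * f x * f y ∂μ ∂μ
      = ∫ p : X × X, ∫ ω, c * ((φ ω p.1 * f p.1) * (φ ω p.2 * f p.2)) ∂ν ∂(μ.prod μ) := by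
    rw [← integral_prod _ hki]
    refine integral_congr_ae (.of_forall fun p => ?_)
    simp only [hk]
    rw [← integral_const_mul, ← integral_mul_const, ← integral_mul_const]
    refine integral_congr_ae (.of_forall fun ω => ?_)
    simp only
    ring
  rw [hrw, integral_integral_swap hint]
  refine integral_nonneg fun ω => ?_
  rw [integral_const_mul, integral_prod_mul (fun x => φ ω x * f x) (fun x => φ ω x * f x)]
  exact mul_nonneg hc (mul_self_nonneg _)

theorem integrable_exp_neg_mul_sq_norm_sub {b : ℝ} (hb : 0 < b) (m : Ed d) :
    Integrable fun z : Ed d => Real.exp (-b * ‖z - m‖ ^ 2) := by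
  have h := (GaussianFourier.integrable_cexp_neg_mul_sq_norm_add (V := Ed d) (b := (b : ℂ))
    (by simpa using hb) 0 0).norm
  have h' : Integrable fun z : Ed d => Real.exp (-b * ‖z‖ ^ 2) := by
    convert h using 2 with z
    rw [Complex.norm_exp]
    simp [← Complex.ofReal_pow]
  exact h'.comp_sub_right m

theorem integral_exp_neg_mul_sq_norm_sub {b : ℝ} (hb : 0 < b) (m : Ed d) :
    ∫ z : Ed d, Real.exp (-b * ‖z - m‖ ^ 2) = (Real.pi / b) ^ ((d : ℝ) / 2) := by
  rw [integral_sub_right_eq_self (fun z : Ed d => Real.exp (-b * ‖z‖ ^ 2)) m,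
    GaussianFourier.integral_rexp_neg_mul_sq_norm hb]
  simp

theorem exp_mul_exp_neg_mul_sq_norm_sub (b : ℝ) (x y z : Ed d) :
    Real.exp (-b * ‖z - x‖ ^ 2) * Real.exp (-b * ‖z - y‖ ^ 2)
      = Real.exp (-(b / 2) * ‖x - y‖ ^ 2)
        * Real.exp (-(2 * b) * ‖z - (1 / 2 : ℝ) • (x + y)‖ ^ 2) := by
  rw [← Real.exp_add, ← Real.exp_add]
  congr 1
  simp only [← real_inner_self_eq_norm_sq, inner_sub_left, inner_sub_right, inner_add_left,
    inner_add_right, real_inner_smul_left, real_inner_smul_right, real_inner_comm z x,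
    real_inner_comm z y, real_inner_comm y x]
  ring

theorem integrable_exp_mul_exp_neg_mul_sq_norm_sub {b : ℝ} (hb : 0 < b) (x y : Ed d) :
    Integrable fun z : Ed d =>
      Real.exp (-b * ‖z - x‖ ^ 2) * Real.exp (-b * ‖z - y‖ ^ 2) := by
  simp only [exp_mul_exp_neg_mul_sq_norm_sub]
  exact (integrable_exp_neg_mul_sq_norm_sub (by positivity) _).const_mul _

theorem integral_exp_mul_exp_neg_mul_sq_norm_sub {b : ℝ} (hb : 0 < b) (x y : Ed d) :
    ∫ z : Ed d, Real.exp (-b * ‖z - x‖ ^ 2) * Real.exp (-b * ‖z - y‖ ^ 2)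
      = Real.exp (-(b / 2) * ‖x - y‖ ^ 2) * (Real.pi / (2 * b)) ^ ((d : ℝ) / 2) := by
  simp only [exp_mul_exp_neg_mul_sq_norm_sub]
  rw [integral_const_mul, integral_exp_neg_mul_sq_norm_sub (by positivity)]

theorem indicator_Iic_mul_indicator_Iic (s t u : ℝ) :
    (Set.Iic s).indicator (1 : ℝ → ℝ) u * (Set.Iic t).indicator (1 : ℝ → ℝ) u
      = (Set.Iic (min s t)).indicator (1 : ℝ → ℝ) u := by
  rw [← Set.Iic_inter_Iic, Set.inter_indicator_one, Pi.mul_apply]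

theorem integrable_indicator_Iic_mul_indicator_Iic (s t : ℝ) :
    Integrable (fun u => (Set.Iic s).indicator (1 : ℝ → ℝ) u
      * (Set.Iic t).indicator (1 : ℝ → ℝ) u) (volume.restrict (Set.Ioi 0)) := by
  simp only [indicator_Iic_mul_indicator_Iic]
  refine (integrable_indicator_iff measurableSet_Iic).2 (integrableOn_const ?_)
  rw [Measure.restrict_apply measurableSet_Iic, Set.inter_comm, Set.Ioi_inter_Iic]
  simp

theorem integral_indicator_Iic_mul_indicator_Iic {s t : ℝ} (hs : 0 ≤ s) (ht : 0 ≤ t) :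
    ∫ u in Set.Ioi 0, (Set.Iic s).indicator (1 : ℝ → ℝ) u
      * (Set.Iic t).indicator (1 : ℝ → ℝ) u = min s t := by
  simp only [indicator_Iic_mul_indicator_Iic]
  rw [integral_indicator_one measurableSet_Iic, measureReal_restrict_apply measurableSet_Iic,
    Set.inter_comm, Set.Ioi_inter_Iic, Real.volume_real_Ioc_of_le (le_min hs ht), sub_zero]

theorem stdGauss_pos (x : Ed d) : 0 < stdGauss d x := by
  unfold stdGauss
  positivity

theorem measurable_stdGauss : Measurable (stdGauss d) := by
  unfold stdGauss
  fun_prop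

theorem gaussDens_pos {v : ℝ} (hv : 0 < v) (m y : Ed d) : 0 < gaussDens m v y := by
  unfold gaussDens
  positivity

theorem gaussDens_eq (m : Ed d) (v : ℝ) (y : Ed d) :
    gaussDens m v y
      = (2 * Real.pi * v) ^ (-(d : ℝ) / 2) * Real.exp (-(1 / (2 * v)) * ‖y - m‖ ^ 2) := by
  rw [gaussDens]
  congr 2
  ring

theorem integrable_gaussDens {v : ℝ} (hv : 0 < v) (m : Ed d) : Integrable (gaussDens m v) := by
  simp only [funext (gaussDens_eq m v)]
  exact (integrable_exp_neg_mul_sq_norm_sub (by positivity) m).const_mul _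

theorem integral_gaussDens {v : ℝ} (hv : 0 < v) (m : Ed d) : ∫ y, gaussDens m v y = 1 := by
  simp only [gaussDens_eq]
  rw [integral_const_mul, integral_exp_neg_mul_sq_norm_sub (by positivity)]
  have h : Real.pi / (1 / (2 * v)) = 2 * Real.pi * v := by field_simp
  rw [h, ← Real.rpow_add (by positivity), neg_div, neg_add_cancel, Real.rpow_zero]

theorem propDens_variance_pos {σ θ : ℝ} (hσ : 0 < σ) (hθ : 0 ≤ θ) :
    0 < σ ^ 2 * (1 / (1 + θ * σ ^ 2)) := by
  positivity

theorem propDens_pos {σ θ : ℝ} (hσ : 0 < σ) (hθ : 0 ≤ θ) (x y : Ed d) : 0 < propDens σ θ x y :=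
  gaussDens_pos (propDens_variance_pos hσ hθ) _ _

theorem measurable_propDens (σ θ : ℝ) : Measurable fun p : Ed d × Ed d => propDens σ θ p.1 p.2 := by
  unfold propDens gaussDens
  generalize 1 / (1 + θ * σ ^ 2) = ρ
  fun_prop

theorem integrable_propDens {σ θ : ℝ} (hσ : 0 < σ) (hθ : 0 ≤ θ) (x : Ed d) :
    Integrable (propDens σ θ x) :=
  integrable_gaussDens (propDens_variance_pos hσ hθ) _

theorem integral_propDens {σ θ : ℝ} (hσ : 0 < σ) (hθ : 0 ≤ θ) (x : Ed d) :
    ∫ y, propDens σ θ x y = 1 :=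
  integral_gaussDens (propDens_variance_pos hσ hθ) _

theorem measurable_stdGauss_mul_propDens (σ θ : ℝ) {X : Type*} [MeasurableSpace X]
    {u w : X → Ed d} (hu : Measurable u) (hw : Measurable w) :
    Measurable fun p => stdGauss d (u p) * propDens σ θ (u p) (w p) := by
  unfold stdGauss propDens gaussDens
  generalize 1 / (1 + θ * σ ^ 2) = ρ
  fun_prop

theorem measurable_alphaMH (σ θ : ℝ) : Measurable fun p : Ed d × Ed d => alphaMH σ θ p.1 p.2 :=
  measurable_const.min
    ((measurable_stdGauss_mul_propDens σ θ measurable_snd measurable_fst).div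
      (measurable_stdGauss_mul_propDens σ θ measurable_fst measurable_snd))

theorem alphaMH_le_one (σ θ : ℝ) (x y : Ed d) : alphaMH σ θ x y ≤ 1 :=
  min_le_left _ _

theorem alphaMH_nonneg {σ θ : ℝ} (hσ : 0 < σ) (hθ : 0 ≤ θ) (x y : Ed d) :
    0 ≤ alphaMH σ θ x y := by
  have := stdGauss_pos x
  have := stdGauss_pos y
  have := propDens_pos hσ hθ x y
  have := propDens_pos hσ hθ y x
  unfold alphaMH
  positivity

theorem stdGauss_mul_propDens_mul_alphaMH {σ θ : ℝ} (hσ : 0 < σ) (hθ : 0 ≤ θ) (x y : Ed d) :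
    stdGauss d x * propDens σ θ x y * alphaMH σ θ x y
      = min (stdGauss d x * propDens σ θ x y) (stdGauss d y * propDens σ θ y x) := by
  have h : 0 < stdGauss d x * propDens σ θ x y :=
    mul_pos (stdGauss_pos x) (propDens_pos hσ hθ x y)
  rw [alphaMH, mul_min_of_nonneg _ _ h.le, mul_one, mul_div_cancel₀ _ h.ne']

theorem abarMH_nonneg {σ θ : ℝ} (hσ : 0 < σ) (hθ : 0 ≤ θ) (x : Ed d) : 0 ≤ abarMH d σ θ x :=
  integral_nonneg fun y => mul_nonneg (propDens_pos hσ hθ x y).le (alphaMH_nonneg hσ hθ x y)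

theorem abarMH_le_one {σ θ : ℝ} (hσ : 0 < σ) (hθ : 0 ≤ θ) (x : Ed d) : abarMH d σ θ x ≤ 1 := by
  rw [← integral_propDens hσ hθ x]
  refine integral_mono_of_nonneg (.of_forall fun y => ?_) (integrable_propDens hσ hθ x)
    (.of_forall fun y => ?_)
  · exact mul_nonneg (propDens_pos hσ hθ x y).le (alphaMH_nonneg hσ hθ x y)
  · exact mul_le_of_le_one_right (propDens_pos hσ hθ x y).le (alphaMH_le_one σ θ x y)

theorem measurable_abarMH (σ θ : ℝ) : Measurable (abarMH d σ θ) := by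
  have h : StronglyMeasurable fun p : Ed d × Ed d => propDens σ θ p.1 p.2 * alphaMH σ θ p.1 p.2 :=
    ((measurable_propDens σ θ).mul (measurable_alphaMH σ θ)).stronglyMeasurable
  exact h.integral_prod_right'.measurable

theorem integrable_sq_mul_stdGauss_mul_propDens {σ θ : ℝ} (hσ : 0 < σ) (hθ : 0 ≤ θ)
    {f : Ed d → ℝ} (hf : Measurable f) (hf2 : Integrable fun x => f x ^ 2 * stdGauss d x) :
    Integrable (fun p : Ed d × Ed d => f p.1 ^ 2 * stdGauss d p.1 * propDens σ θ p.1 p.2)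
      (volume.prod volume) := by
  have hg := measurable_stdGauss (d := d)
  have hp := measurable_propDens (d := d) σ θ
  refine (integrable_prod_iff (by fun_prop)).2 ⟨.of_forall fun x => ?_, ?_⟩
  · exact (integrable_propDens hσ hθ x).const_mul (f x ^ 2 * stdGauss d x)
  · convert hf2 using 2 with x
    have h0 : 0 ≤ f x ^ 2 * stdGauss d x := mul_nonneg (sq_nonneg _) (stdGauss_pos x).le
    simp only [norm_mul _ (propDens σ θ _ _), Real.norm_of_nonneg h0,
      Real.norm_of_nonneg (propDens_pos hσ hθ _ _).le]
    rw [integral_const_mul, integral_propDens hσ hθ, mul_one]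

theorem integrable_kernel_mul {σ θ : ℝ} (hσ : 0 < σ) (hθ : 0 ≤ θ)
    {f : Ed d → ℝ} (hf : Measurable f) (hf2 : Integrable fun x => f x ^ 2 * stdGauss d x) :
    Integrable (fun p : Ed d × Ed d =>
        stdGauss d p.1 * propDens σ θ p.1 p.2 * alphaMH σ θ p.1 p.2 * f p.1 * f p.2)
      (volume.prod volume) := by
  have h₁ := integrable_sq_mul_stdGauss_mul_propDens hσ hθ hf hf2
  have hg := measurable_stdGauss (d := d)
  have hp := measurable_propDens (d := d) σ θ
  have ha := measurable_alphaMH (d := d) σ θ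
  refine (h₁.add h₁.swap).mono' (by fun_prop) (.of_forall fun ⟨x, y⟩ => ?_)
  have hx : 0 < stdGauss d x * propDens σ θ x y :=
    mul_pos (stdGauss_pos x) (propDens_pos hσ hθ x y)
  have hy : 0 < stdGauss d y * propDens σ θ y x :=
    mul_pos (stdGauss_pos y) (propDens_pos hσ hθ y x)
  simp only [Pi.add_apply, Function.comp_apply, Prod.swap_prod_mk,
    stdGauss_mul_propDens_mul_alphaMH hσ hθ]
  have hk := le_min hx.le hy.le
  have hkx := mul_le_mul_of_nonneg_right
    (min_le_left (stdGauss d x * propDens σ θ x y) (stdGauss d y * propDens σ θ y x))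
    (sq_nonneg (f x))
  have hky := mul_le_mul_of_nonneg_right
    (min_le_right (stdGauss d x * propDens σ θ x y) (stdGauss d y * propDens σ θ y x))
    (sq_nonneg (f y))
  rw [mul_assoc, norm_mul, Real.norm_of_nonneg hk, norm_mul, Real.norm_eq_abs, Real.norm_eq_abs]
  have habs : |f x| * |f y| ≤ f x ^ 2 + f y ^ 2 := by
    nlinarith [sq_nonneg (|f x| - |f y|), sq_abs (f x), sq_abs (f y), sq_nonneg (f x),
      sq_nonneg (f y)]
  have := mul_le_mul_of_nonneg_left habs hk
  linarith

/-- The flow `π(x) g(x,y)` is a symmetric positive kernel times a function of `x`. -/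
theorem stdGauss_mul_propDens_eq {σ θ : ℝ} (hσ : 0 < σ) (hθ : 0 ≤ θ) :
    ∃ (C b p q : ℝ), 0 ≤ C ∧ 0 < b ∧ ∀ x y : Ed d, stdGauss d x * propDens σ θ x y
      = C * Real.exp (-(b / 2) * ‖x - y‖ ^ 2)
        * (Real.exp (p * ‖x‖ ^ 2) * Real.exp (p * ‖y‖ ^ 2)) * Real.exp (q * ‖x‖ ^ 2) := by
  have hv := propDens_variance_pos hσ hθ
  have hρ : 0 < 1 / (1 + θ * σ ^ 2) := by positivity
  unfold propDens gaussDens stdGauss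
  set v := σ ^ 2 * (1 / (1 + θ * σ ^ 2))
  set ρ := 1 / (1 + θ * σ ^ 2)
  refine ⟨(2 * Real.pi) ^ (-(d : ℝ) / 2) * (2 * Real.pi * v) ^ (-(d : ℝ) / 2), ρ / v,
    -(1 - ρ) / (2 * v), -1 / 2 + (ρ - ρ ^ 2) / (2 * v) + (1 - ρ) / (2 * v), by positivity,
    by positivity, fun x y => ?_⟩
  have hexp : Real.exp (-‖x‖ ^ 2 / 2) * Real.exp (-‖y - ρ • x‖ ^ 2 / (2 * v))
      = Real.exp (-(ρ / v / 2) * ‖x - y‖ ^ 2) * (Real.exp (-(1 - ρ) / (2 * v) * ‖x‖ ^ 2)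
        * Real.exp (-(1 - ρ) / (2 * v) * ‖y‖ ^ 2))
        * Real.exp ((-1 / 2 + (ρ - ρ ^ 2) / (2 * v) + (1 - ρ) / (2 * v)) * ‖x‖ ^ 2) := by
    simp only [← Real.exp_add]
    congr 1
    simp only [← real_inner_self_eq_norm_sq, inner_sub_left, inner_sub_right,
      real_inner_smul_left, real_inner_smul_right, real_inner_comm y x]
    field_simp
    ring
  linear_combination ((2 * Real.pi) ^ (-(d : ℝ) / 2) * (2 * Real.pi * v) ^ (-(d : ℝ) / 2)) * hexp

/-- The accepted flow is a nonnegative superposition of rank-one kernels. -/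
theorem exists_kernel_eq_integral {σ θ : ℝ} (hσ : 0 < σ) (hθ : 0 ≤ θ) :
    ∃ (c : ℝ) (φ : Ed d × ℝ → Ed d → ℝ), 0 ≤ c ∧
      (Measurable fun p : (Ed d × ℝ) × Ed d => φ p.1 p.2) ∧ (∀ ω x, 0 ≤ φ ω x) ∧
      (∀ x y, Integrable (fun ω => φ ω x * φ ω y)
        ((volume : Measure (Ed d)).prod (volume.restrict (Set.Ioi 0)))) ∧
      ∀ x y, stdGauss d x * propDens σ θ x y * alphaMH σ θ x y
        = c * ∫ ω, φ ω x * φ ω y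
          ∂((volume : Measure (Ed d)).prod (volume.restrict (Set.Ioi 0))) := by
  obtain ⟨C, b, p, q, hC, hb, hflow⟩ := stdGauss_mul_propDens_eq (d := d) hσ hθ
  set w : Ed d → ℝ := fun x => Real.exp (p * ‖x‖ ^ 2)
  set r : Ed d → ℝ := fun x => Real.exp (q * ‖x‖ ^ 2)
  have hsplit : ∀ (x y : Ed d) (ω : Ed d × ℝ),
      (w x * Real.exp (-b * ‖ω.1 - x‖ ^ 2) * (Set.Iic (r x)).indicator 1 ω.2)
        * (w y * Real.exp (-b * ‖ω.1 - y‖ ^ 2) * (Set.Iic (r y)).indicator 1 ω.2)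
      = w x * w y * ((Real.exp (-b * ‖ω.1 - x‖ ^ 2) * Real.exp (-b * ‖ω.1 - y‖ ^ 2))
        * ((Set.Iic (r x)).indicator (1 : ℝ → ℝ) ω.2
          * (Set.Iic (r y)).indicator (1 : ℝ → ℝ) ω.2)) := fun x y ω => by ring
  refine ⟨C / (Real.pi / (2 * b)) ^ ((d : ℝ) / 2),
    fun ω x => w x * Real.exp (-b * ‖ω.1 - x‖ ^ 2) * (Set.Iic (r x)).indicator 1 ω.2,
    by positivity, ?_, fun ω x => ?_, fun x y => ?_, fun x y => ?_⟩
  · refine Measurable.mul (by fun_prop) ?_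
    have hset : MeasurableSet {p : (Ed d × ℝ) × Ed d | p.1.2 ≤ r p.2} :=
      measurableSet_le (by fun_prop) (by fun_prop)
    exact (measurable_const (a := (1 : ℝ))).indicator hset
  · exact mul_nonneg (by positivity) (Set.indicator_nonneg (fun _ _ => zero_le_one) _)
  · simp only [hsplit]
    exact ((integrable_exp_mul_exp_neg_mul_sq_norm_sub hb x y).mul_prod
      (integrable_indicator_Iic_mul_indicator_Iic (r x) (r y))).const_mul _
  · simp only [hsplit]
    have hsymm : stdGauss d y * propDens σ θ y x
        = C * Real.exp (-(b / 2) * ‖x - y‖ ^ 2) * (w x * w y) * r y := by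
      rw [hflow, norm_sub_rev, mul_comm (w x)]
    rw [integral_const_mul, integral_prod_mul
      (fun z : Ed d => Real.exp (-b * ‖z - x‖ ^ 2) * Real.exp (-b * ‖z - y‖ ^ 2))
      (fun u => (Set.Iic (r x)).indicator (1 : ℝ → ℝ) u * (Set.Iic (r y)).indicator (1 : ℝ → ℝ) u),
      integral_exp_mul_exp_neg_mul_sq_norm_sub hb,
      integral_indicator_Iic_mul_indicator_Iic (Real.exp_nonneg _) (Real.exp_nonneg _),
      stdGauss_mul_propDens_mul_alphaMH hσ hθ, hsymm, hflow, ← mul_min_of_nonneg _ _ (by positivity)]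
    have hG : (Real.pi / (2 * b)) ^ ((d : ℝ) / 2) ≠ 0 := by positivity
    simp only [w, r]
    field_simp

/-- The ideal Metropolis–Hastings kernel with Gaussian target, proposal
`N(ρx, σ²ρ·I_d)` (`ρ = 1/(1+θσ²)`) and acceptance `α`, is a positive operator on
`L²(π)`: all the relevant integrals are well defined and
`∫∫ π(x) g(x,y) α(x,y) f(x) f(y) dy dx + ∫ π(x)(1-ᾱ(x)) f(x)² dx ≥ 0`. -/
theorem ideal_kernel_positive
    (d : ℕ) (hd : 1 ≤ d) (σ θ : ℝ) (hσ : 0 < σ) (hθ : 0 ≤ θ)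
    (f : Ed d → ℝ) (hf_meas : Measurable f)
    (hf2 : Integrable fun x => f x ^ 2 * stdGauss d x) :
    (Integrable
      (fun p : Ed d × Ed d =>
        stdGauss d p.1 * propDens σ θ p.1 p.2 * alphaMH σ θ p.1 p.2 * f p.1 * f p.2)
      (volume.prod volume)) ∧
    (Integrable fun x : Ed d => stdGauss d x * (1 - abarMH d σ θ x) * f x ^ 2) ∧
    0 ≤ (∫ x : Ed d, ∫ y : Ed d,
          stdGauss d x * propDens σ θ x y * alphaMH σ θ x y * f x * f y) +
        ∫ x : Ed d, stdGauss d x * (1 - abarMH d σ θ x) * f x ^ 2 := by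
  have hki := integrable_kernel_mul hσ hθ hf_meas hf2
  refine ⟨hki, ?_, add_nonneg ?_ (integral_nonneg fun x => ?_)⟩
  · have hg := measurable_stdGauss (d := d)
    have ha := measurable_abarMH (d := d) σ θ
    refine hf2.mono' (by fun_prop) (.of_forall fun x => ?_)
    have h₀ := abarMH_nonneg hσ hθ x
    have h₁ := abarMH_le_one hσ hθ x
    have hx : 0 ≤ f x ^ 2 * stdGauss d x := mul_nonneg (sq_nonneg _) (stdGauss_pos x).le
    rw [Real.norm_of_nonneg (mul_nonneg (mul_nonneg (stdGauss_pos x).le (sub_nonneg.2 h₁))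
      (sq_nonneg _))]
    nlinarith [mul_nonneg hx h₀]
  · obtain ⟨c, φ, hc, hφ, hφ0, hφi, hk⟩ := exists_kernel_eq_integral (d := d) hσ hθ
    exact integral_kernel_nonneg hc hφ hφ0 hf_meas hφi hk hki
  · exact mul_nonneg (mul_nonneg (stdGauss_pos x).le (sub_nonneg.2 (abarMH_le_one hσ hθ x)))
      (sq_nonneg _)

end
end
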